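/- Let F be a rotation-invariant function on the real d×d symmetric matrices whose restriction to the diagonal matrices is C^{n,α} (n-th derivative Hölder continuous of exponent α ∈ (0,1)). Then F is C^{n,α}. -/

import Mathlib

open Matrix

attribute [local instance] Matrix.frobeniusNormedAddCommGroup Matrix.frobeniusNormedSpace

/-- The space of real symmetric `d × d` matrices, as a submodule of the matrix space. -/
def SymMat (d : ℕ) : Submodule ℝ (Matrix (Fin d) (Fin d) ℝ) where
  carrier := {A | A.IsSymm}
  add_mem' := Matrix.IsSymm.add
  zero_mem' := Matrix.isSymm_zero
  smul_mem' := fun c _ h => h.smul c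

/-- A function is `C^{n,α}` if it is `C^n` and its `n`-th derivative is locally
`α`-Hölder continuous. -/
def IsCnHolder {E F : Type*} [NormedAddCommGroup E] [NormedSpace ℝ E]
    [NormedAddCommGroup F] [NormedSpace ℝ F] (n : ℕ) (α : NNReal) (f : E → F) : Prop :=
  ContDiff ℝ n f ∧
    ∀ x : E, ∃ C : NNReal, ∃ s ∈ nhds x, HolderOnWith C α (iteratedFDeriv ℝ n f) s

/-- The polynomial `z ^ N * q (c * (z - z⁻¹))`. -/
noncomputable def joukowskiLift (q : Polynomial ℂ) (N : ℕ) (c z : ℂ) : ℂ :=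
  ∑ k ∈ Finset.range (N + 1), q.coeff k * (c * (z ^ 2 - 1)) ^ k * z ^ (N - k)

theorem joukowskiLift_eq {q : Polynomial ℂ} {N : ℕ} (hq : q.natDegree ≤ N) (c : ℂ) {z : ℂ}
    (hz : z ≠ 0) : joukowskiLift q N c z = z ^ N * q.eval (c * (z - z⁻¹)) := by
  rw [Polynomial.eval_eq_sum_range' (Nat.lt_succ_of_le hq), joukowskiLift, Finset.mul_sum]
  refine Finset.sum_congr rfl fun k hk => ?_
  have hk' : k ≤ N := Nat.lt_succ_iff.mp (Finset.mem_range.mp hk)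
  have h1 : c * (z ^ 2 - 1) = z * (c * (z - z⁻¹)) := by field_simp
  have h2 : z ^ N = z ^ k * z ^ (N - k) := by rw [← pow_add, Nat.add_sub_cancel' hk']
  rw [h1, h2, mul_pow]
  ring

theorem norm_joukowskiLift_le {p : Polynomial ℝ} {N : ℕ} (hd : p.natDegree ≤ N) {A : ℝ}
    (h : ∀ t : ℝ, |t| ≤ 1 → |p.eval t| ≤ A) {s : ℝ} (hs : |s| = 1) {z : ℂ} (hz : ‖z‖ ≤ 1) :
    ‖joukowskiLift (p.map Complex.ofRealHom) N (s / (2 * Complex.I)) z‖ ≤ A := by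
  have hd' : (p.map Complex.ofRealHom).natDegree ≤ N := Polynomial.natDegree_map_le.trans hd
  have hdiff : Differentiable ℂ
      (joukowskiLift (p.map Complex.ofRealHom) N (s / (2 * Complex.I))) := by
    unfold joukowskiLift; fun_prop
  have hcl : z ∈ closure (Metric.ball (0 : ℂ) 1) := by
    rw [closure_ball _ one_ne_zero]; simpa using hz
  refine Complex.norm_le_of_forall_mem_frontier_norm_le Metric.isBounded_ball
    hdiff.diffContOnCl (fun w hw => ?_) hcl
  rw [frontier_ball _ one_ne_zero] at hw
  have hw1 : ‖w‖ = 1 := by simpa using hw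
  have hw0 : w ≠ 0 := by rintro rfl; simp at hw1
  rw [joukowskiLift_eq hd' _ hw0]
  have h1 : (s / (2 * Complex.I) : ℂ) * (w - w⁻¹) = ((s * w.im : ℝ) : ℂ) := by
    rw [Complex.inv_eq_conj hw1, Complex.sub_conj]
    field_simp
    push_cast
    ring
  rw [h1, norm_mul, norm_pow, hw1, one_pow, one_mul]
  have h2 : (p.map Complex.ofRealHom).eval ((s * w.im : ℝ) : ℂ) = ((p.eval (s * w.im) : ℝ) : ℂ) :=
    Polynomial.eval_map_apply Complex.ofRealHom _
  rw [h2, Complex.norm_real, Real.norm_eq_abs]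
  apply h
  rw [abs_mul, hs, one_mul]
  exact (Complex.abs_im_le_norm w).trans hw1.le

theorem norm_eval_sin_le {p : Polynomial ℝ} {N : ℕ} (hd : p.natDegree ≤ N) {A : ℝ}
    (h : ∀ t : ℝ, |t| ≤ 1 → |p.eval t| ≤ A) (w : ℂ) :
    ‖(p.map Complex.ofRealHom).eval (Complex.sin w)‖ ≤ A * Real.exp (N * |w.im|) := by
  have hd' : (p.map Complex.ofRealHom).natDegree ≤ N := Polynomial.natDegree_map_le.trans hd
  have key : ∀ s : ℝ, |s| = 1 → 0 ≤ s * w.im →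
      ‖(p.map Complex.ofRealHom).eval (Complex.sin w)‖ ≤ A * Real.exp (N * (s * w.im)) := by
    intro s hs hw
    have hss : s * s = 1 := by rw [← abs_mul_abs_self, hs, one_mul]
    set z : ℂ := Complex.exp (s * w * Complex.I) with hzdef
    have hz : ‖z‖ = Real.exp (-(s * w.im)) := by
      rw [hzdef, Complex.norm_exp]; simp
    have hz0 : z ≠ 0 := Complex.exp_ne_zero _
    have h1 := norm_joukowskiLift_le hd h hs (z := z) (by rw [hz]; simpa using hw)
    have h2 : (s / (2 * Complex.I) : ℂ) * (z - z⁻¹) = Complex.sin w := by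
      have : Complex.sin (s * w) = s * Complex.sin w := by
        rcases (abs_eq zero_le_one).mp hs with rfl | rfl <;> simp
      have h3 : Complex.sin w = s * Complex.sin (s * w) := by
        rw [this, ← mul_assoc, ← Complex.ofReal_mul, hss, Complex.ofReal_one, one_mul]
      rw [h3, Complex.sin, hzdef, ← Complex.exp_neg]
      have hI : Complex.I ≠ 0 := Complex.I_ne_zero
      have h4 : -(↑s * w) * Complex.I = -(s * w * Complex.I) := by ring
      rw [h4]
      field_simp
      rw [Complex.I_sq]; ring
    rw [joukowskiLift_eq hd' _ hz0, h2, norm_mul, norm_pow, hz, ← Real.exp_nat_mul] at h1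
    have h5 : Real.exp (N * (s * w.im)) * Real.exp (N * -(s * w.im)) = 1 := by
      rw [← Real.exp_add]; simp
    calc _ = Real.exp (N * (s * w.im)) * (Real.exp (N * -(s * w.im)) *
          ‖(p.map Complex.ofRealHom).eval (Complex.sin w)‖) := by rw [← mul_assoc, h5, one_mul]
      _ ≤ Real.exp (N * (s * w.im)) * A := by gcongr
      _ = _ := mul_comm _ _
  rcases le_total 0 w.im with hw | hw
  · simpa [abs_of_nonneg hw] using key 1 (by simp) (by simpa using hw)
  · simpa [abs_of_nonpos hw] using key (-1) (by simp) (by simpa using hw)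

/-- A **Bernstein inequality** at the centre of the interval `[-1, 1]`. -/
theorem abs_derivative_eval_zero_le {p : Polynomial ℝ} {N : ℕ} (hN : 0 < N)
    (hd : p.natDegree ≤ N) {A : ℝ} (h : ∀ t : ℝ, |t| ≤ 1 → |p.eval t| ≤ A) :
    |p.derivative.eval 0| ≤ Real.exp 1 * N * A := by
  set q := p.map Complex.ofRealHom with hq
  have hN' : (0 : ℝ) < N := by exact_mod_cast hN
  have hA : 0 ≤ A := (abs_nonneg _).trans (h 0 (by simp))
  have hder : HasDerivAt (fun w => q.eval (Complex.sin w)) ((p.derivative.eval 0 : ℝ) : ℂ) 0 := by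
    have h1 : HasDerivAt (fun w : ℂ => q.eval w) (q.derivative.eval (Complex.sin 0))
      (Complex.sin 0) := q.hasDerivAt _
    have h2 := h1.comp (0 : ℂ) (Complex.hasDerivAt_sin 0)
    have h3 : q.derivative.eval (Complex.sin 0) * Complex.cos 0 =
        ((p.derivative.eval 0 : ℝ) : ℂ) := by
      rw [Complex.cos_zero, mul_one, Complex.sin_zero, hq, Polynomial.derivative_map]
      have := Polynomial.eval_map_apply Complex.ofRealHom (p := p.derivative) 0
      simp
    rw [← h3]; exact h2
  have hdiff : Differentiable ℂ (fun w => q.eval (Complex.sin w)) :=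
    q.differentiable.comp Complex.differentiable_sin
  have hc := Complex.norm_deriv_le_of_forall_mem_sphere_norm_le (c := 0) (R := (N : ℝ)⁻¹)
    (C := A * Real.exp 1) (inv_pos.mpr hN') hdiff.diffContOnCl (fun w hw => by
      refine (norm_eval_sin_le hd h w).trans ?_
      gcongr
      have hw' : ‖w‖ = (N : ℝ)⁻¹ := by simpa using hw
      calc (N : ℝ) * |w.im| ≤ N * (N : ℝ)⁻¹ := by
            gcongr; exact (Complex.abs_im_le_norm w).trans hw'.le
        _ = 1 := mul_inv_cancel₀ hN'.ne')
  rw [hder.deriv, Complex.norm_real, Real.norm_eq_abs, div_inv_eq_mul] at hc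
  linarith

theorem MvPolynomial.totalDegree_pderiv_le {σ R : Type*} [CommSemiring R] (i : σ)
    (P : MvPolynomial σ R) : (MvPolynomial.pderiv i P).totalDegree ≤ P.totalDegree := by
  classical
  conv_lhs => rw [P.as_sum, map_sum]
  refine MvPolynomial.totalDegree_finsetSum_le fun s hs => ?_
  rw [MvPolynomial.pderiv_monomial]
  refine (MvPolynomial.totalDegree_monomial_le _ _).trans ?_
  refine le_trans ?_ (MvPolynomial.le_totalDegree hs)
  have h : s - Finsupp.single i 1 ≤ s := tsub_le_self
  exact Finsupp.degree_mono h

section PolyMap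

variable {E ι : Type*} [NormedAddCommGroup E] [NormedSpace ℝ E]

/-- The function obtained by substituting continuous linear functionals in a polynomial. -/
noncomputable def polyMap (ℓ : ι → E →L[ℝ] ℝ) (P : MvPolynomial ι ℝ) (x : E) : ℝ :=
  MvPolynomial.eval (fun i => ℓ i x) P

theorem contDiff_polyMap (ℓ : ι → E →L[ℝ] ℝ) (P : MvPolynomial ι ℝ) {m : WithTop ℕ∞} :
    ContDiff ℝ m (polyMap ℓ P) := by
  unfold polyMap
  induction P using MvPolynomial.induction_on with
  | C a => simpa using contDiff_const
  | add p q hp hq => simpa using hp.add hq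
  | mul_X p i hp => simpa using hp.mul (ℓ i).contDiff

theorem exists_polyMap_line (ℓ : ι → E →L[ℝ] ℝ) (P : MvPolynomial ι ℝ) (x y : E) :
    ∃ p : Polynomial ℝ, p.natDegree ≤ P.totalDegree ∧
      ∀ t : ℝ, p.eval t = polyMap ℓ P (x + t • y) := by
  refine ⟨MvPolynomial.aeval (fun i => Polynomial.C (ℓ i x) + Polynomial.X * Polynomial.C (ℓ i y))
    P, ?_, fun t => ?_⟩
  · have := MvPolynomial.aeval_natDegree_le P le_rfl
      (fun i => Polynomial.C (ℓ i x) + Polynomial.X * Polynomial.C (ℓ i y)) (n := 1) (fun i => by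
        compute_degree)
    simpa using this
  · rw [polyMap, ← Polynomial.coe_evalRingHom, ← MvPolynomial.eval₂_id, MvPolynomial.aeval_def,
      MvPolynomial.hom_eval₂]
    congr 1
    · ext; simp
    · ext i; simp [mul_comm t]

/-- **Bernstein inequality** for polynomial maps on a normed space. -/
theorem abs_fderiv_polyMap_le (ℓ : ι → E →L[ℝ] ℝ) {P : MvPolynomial ι ℝ} {N : ℕ} (hN : 0 < N)
    (hP : P.totalDegree ≤ N) {x : E} {δ : ℝ} (hδ : 0 < δ) {A : ℝ}
    (hA : ∀ z ∈ Metric.closedBall x δ, |polyMap ℓ P z| ≤ A) (y : E) :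
    |fderiv ℝ (polyMap ℓ P) x y| ≤ Real.exp 1 * N / δ * A * ‖y‖ := by
  rcases eq_or_ne y 0 with rfl | hy
  · simp
  have hy' : 0 < ‖y‖ := norm_pos_iff.mpr hy
  obtain ⟨p, hpd, hp⟩ := exists_polyMap_line ℓ P x ((δ / ‖y‖) • y)
  have hb := abs_derivative_eval_zero_le hN (hpd.trans hP) (A := A) (fun t ht => by
    rw [hp]
    apply hA
    rw [mem_closedBall_iff_norm, add_sub_cancel_left, norm_smul, norm_smul, Real.norm_eq_abs,
      Real.norm_eq_abs, abs_of_pos (div_pos hδ hy'), div_mul_cancel₀ _ hy'.ne']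
    exact mul_le_of_le_one_left hδ.le ht)
  have hd : p.derivative.eval 0 = fderiv ℝ (polyMap ℓ P) x ((δ / ‖y‖) • y) := by
    have h1 : HasDerivAt (fun t : ℝ => x + t • ((δ / ‖y‖) • y)) ((δ / ‖y‖) • y) 0 := by
      simpa using ((hasDerivAt_id (0 : ℝ)).smul_const ((δ / ‖y‖) • y)).const_add x
    have h2 : HasFDerivAt (polyMap ℓ P) (fderiv ℝ (polyMap ℓ P) x)
        (x + (0 : ℝ) • ((δ / ‖y‖) • y)) := by
      rw [zero_smul, add_zero]
      exact ((contDiff_polyMap ℓ P (m := 1)).differentiable one_ne_zero x).hasFDerivAt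
    have h3 := h2.comp_hasDerivAt (0 : ℝ) h1
    have h4 := p.hasDerivAt (0 : ℝ)
    rw [funext hp] at h4
    exact h4.unique h3
  rw [hd, map_smul, smul_eq_mul, abs_mul, abs_of_pos (div_pos hδ hy')] at hb
  have h5 : |fderiv ℝ (polyMap ℓ P) x y| =
      ‖y‖ / δ * (δ / ‖y‖ * |fderiv ℝ (polyMap ℓ P) x y|) := by
    field_simp
  rw [h5]
  calc _ ≤ ‖y‖ / δ * (Real.exp 1 * N * A) := by gcongr
    _ = _ := by ring

variable [Fintype ι]

/-- The polynomial representing the derivative of `polyMap ℓ P` in the direction `y`. -/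
noncomputable def polyDirDeriv (ℓ : ι → E →L[ℝ] ℝ) (y : E) (P : MvPolynomial ι ℝ) :
    MvPolynomial ι ℝ :=
  ∑ i, MvPolynomial.C (ℓ i y) * MvPolynomial.pderiv i P

theorem totalDegree_polyDirDeriv_le (ℓ : ι → E →L[ℝ] ℝ) (y : E) (P : MvPolynomial ι ℝ) :
    (polyDirDeriv ℓ y P).totalDegree ≤ P.totalDegree := by
  refine MvPolynomial.totalDegree_finsetSum_le fun i _ => ?_
  refine (MvPolynomial.totalDegree_mul _ _).trans ?_
  rw [MvPolynomial.totalDegree_C, zero_add]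
  exact MvPolynomial.totalDegree_pderiv_le i P

theorem hasFDerivAt_polyMap (ℓ : ι → E →L[ℝ] ℝ) (P : MvPolynomial ι ℝ) (x : E) :
    HasFDerivAt (polyMap ℓ P) (∑ i, polyMap ℓ (MvPolynomial.pderiv i P) x • ℓ i) x := by
  classical
  unfold polyMap
  induction P using MvPolynomial.induction_on with
  | C a => simpa using hasFDerivAt_const a x
  | add p q hp hq =>
    have h := hp.add hq
    simp only [map_add, add_smul, Finset.sum_add_distrib]
    exact h
  | mul_X p i hp =>
    have h := hp.mul (ℓ i).hasFDerivAt
    simp only [map_mul, MvPolynomial.eval_X, MvPolynomial.pderiv_mul, map_add,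
      MvPolynomial.pderiv_X]
    convert! h using 1
    rw [Finset.smul_sum, add_comm]
    simp only [add_smul, Finset.sum_add_distrib]
    congr 1
    · refine Finset.sum_congr rfl fun j _ => ?_
      rw [smul_smul, mul_comm]
    · rw [Finset.sum_eq_single i]
      · simp
      · intro j _ hj
        simp [hj.symm]
      · simp

theorem fderiv_polyMap_apply (ℓ : ι → E →L[ℝ] ℝ) (P : MvPolynomial ι ℝ) (x y : E) :
    fderiv ℝ (polyMap ℓ P) x y = polyMap ℓ (polyDirDeriv ℓ y P) x := by
  rw [(hasFDerivAt_polyMap ℓ P x).fderiv]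
  simp [polyMap, polyDirDeriv, mul_comm]

theorem exists_iteratedFDeriv_polyMap_eq (ℓ : ι → E →L[ℝ] ℝ) (P : MvPolynomial ι ℝ) (k : ℕ)
    (m : Fin k → E) : ∃ Q : MvPolynomial ι ℝ, Q.totalDegree ≤ P.totalDegree ∧
      ∀ x, iteratedFDeriv ℝ k (polyMap ℓ P) x m = polyMap ℓ Q x := by
  induction k with
  | zero => exact ⟨P, le_rfl, fun x => by simp⟩
  | succ k ih =>
    obtain ⟨Q, hQd, hQ⟩ := ih (Fin.tail m)
    refine ⟨polyDirDeriv ℓ (m 0) Q, (totalDegree_polyDirDeriv_le _ _ _).trans hQd, fun x => ?_⟩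
    rw [iteratedFDeriv_succ_apply_left, ← fderiv_polyMap_apply, ← funext hQ]
    have hdiff : DifferentiableAt ℝ (iteratedFDeriv ℝ k (polyMap ℓ P)) x :=
      (contDiff_polyMap ℓ P (m := (k + 1 : ℕ))).differentiable_iteratedFDeriv
        (by exact_mod_cast Nat.lt_succ_self k) x
    rw [fderiv_continuousMultilinear_apply_const_apply hdiff]

theorem abs_iteratedFDeriv_polyMap_apply_le (ℓ : ι → E →L[ℝ] ℝ) {P : MvPolynomial ι ℝ} {N : ℕ}
    (hN : 0 < N) (hP : P.totalDegree ≤ N) {x₀ : E} {δ : ℝ} (hδ : 0 < δ) {A : ℝ} (k : ℕ) {r : ℝ}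
    (hA : ∀ z ∈ Metric.closedBall x₀ (r + k * δ), |polyMap ℓ P z| ≤ A)
    (m : Fin k → E) {x : E} (hx : x ∈ Metric.closedBall x₀ r) :
    |iteratedFDeriv ℝ k (polyMap ℓ P) x m| ≤ (Real.exp 1 * N / δ) ^ k * A * ∏ i, ‖m i‖ := by
  induction k generalizing r x with
  | zero => simpa using hA x (by simpa using hx)
  | succ k ih =>
    obtain ⟨Q, hQd, hQ⟩ := exists_iteratedFDeriv_polyMap_eq ℓ P k (Fin.tail m)
    have hdiff : DifferentiableAt ℝ (iteratedFDeriv ℝ k (polyMap ℓ P)) x :=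
      (contDiff_polyMap ℓ P (m := (k + 1 : ℕ))).differentiable_iteratedFDeriv
        (by exact_mod_cast Nat.lt_succ_self k) x
    rw [iteratedFDeriv_succ_apply_left,
      ← fderiv_continuousMultilinear_apply_const_apply hdiff, funext hQ]
    have h1 := abs_fderiv_polyMap_le ℓ hN (hQd.trans hP) hδ (x := x)
      (A := (Real.exp 1 * N / δ) ^ k * A * ∏ i, ‖Fin.tail m i‖) (fun z hz => by
        rw [← hQ]
        refine ih (r := r + δ) (fun w hw => hA w ?_) _ ?_
        · convert! hw using 2
          push_cast; ring
        · rw [Metric.mem_closedBall] at hx hz ⊢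
          linarith [dist_triangle z x x₀]) (m 0)
    refine h1.trans (le_of_eq ?_)
    rw [Fin.prod_univ_succ]
    simp only [Fin.tail]
    ring

theorem norm_iteratedFDeriv_polyMap_le (ℓ : ι → E →L[ℝ] ℝ) {P : MvPolynomial ι ℝ} {N : ℕ}
    (hN : 0 < N) (hP : P.totalDegree ≤ N) {x₀ : E} {δ : ℝ} (hδ : 0 < δ) {A : ℝ} (hA0 : 0 ≤ A)
    (k : ℕ) {r : ℝ} (hA : ∀ z ∈ Metric.closedBall x₀ (r + k * δ), |polyMap ℓ P z| ≤ A)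
    {x : E} (hx : x ∈ Metric.closedBall x₀ r) :
    ‖iteratedFDeriv ℝ k (polyMap ℓ P) x‖ ≤ (Real.exp 1 * N / δ) ^ k * A := by
  refine ContinuousMultilinearMap.opNorm_le_bound (by positivity) fun m => ?_
  exact abs_iteratedFDeriv_polyMap_apply_le ℓ hN hP hδ k hA m hx

end PolyMap

section DyadicLimit

open Filter Topology

theorem exists_limit_of_norm_sub_le_geometric {X V : Type*} [NormedAddCommGroup V]
    [CompleteSpace V] {u : ℕ → X → V} {s : Set X} {C a : ℝ} (ha1 : a < 1)
    (hu : ∀ j, ∀ x ∈ s, ‖u (j + 1) x - u j x‖ ≤ C * a ^ j) :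
    ∃ g : X → V, ∀ x ∈ s, Tendsto (fun j => u j x) atTop (𝓝 (g x)) ∧
      ∀ j, ‖u j x - g x‖ ≤ C * a ^ j / (1 - a) := by
  have h : ∀ x : X, ∃ v, x ∈ s → Tendsto (fun j => u j x) atTop (𝓝 v) ∧
      ∀ j, ‖u j x - v‖ ≤ C * a ^ j / (1 - a) := by
    intro x
    by_cases hx : x ∈ s
    · have hd : ∀ j, dist (u j x) (u (j + 1) x) ≤ C * a ^ j := fun j => by
        rw [dist_comm, dist_eq_norm]; exact hu j x hx
      obtain ⟨v, hv⟩ := cauchySeq_tendsto_of_complete (cauchySeq_of_le_geometric a C ha1 hd)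
      exact ⟨v, fun _ => ⟨hv, fun j => by
        rw [← dist_eq_norm]; exact dist_le_of_le_geometric_of_tendsto a C ha1 hd hv j⟩⟩
    · exact ⟨0, fun h => absurd h hx⟩
  choose g hg using h
  exact ⟨g, hg⟩

theorem tendstoUniformlyOn_of_norm_sub_le_geometric {X V : Type*} [NormedAddCommGroup V]
    {u : ℕ → X → V} {g : X → V} {s : Set X} {C a : ℝ} (ha0 : 0 ≤ a) (ha1 : a < 1)
    (hu : ∀ x ∈ s, ∀ j, ‖u j x - g x‖ ≤ C * a ^ j / (1 - a)) :
    TendstoUniformlyOn u g atTop s := by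
  rw [Metric.tendstoUniformlyOn_iff]
  intro ε hε
  have h : Tendsto (fun j : ℕ => C * a ^ j / (1 - a)) atTop (𝓝 0) := by
    simpa using ((tendsto_pow_atTop_nhds_zero_of_lt_one ha0 ha1).const_mul C).div_const (1 - a)
  filter_upwards [h.eventually (gt_mem_nhds hε)] with j hj x hx
  rw [dist_comm, dist_eq_norm]
  exact (hu x hx j).trans_lt hj

variable {E : Type*} [NormedAddCommGroup E] [NormedSpace ℝ E]

theorem norm_curryLeft_sub_curryLeft {m : ℕ} (f g : E [×(m + 1)]→L[ℝ] ℝ) :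
    ‖f.curryLeft - g.curryLeft‖ = ‖f - g‖ :=
  (f - g).curryLeft_norm

theorem hasFTaylorSeriesUpToOn_of_norm_iteratedFDeriv_sub_le {F : E → ℝ} {G : ℕ → E → ℝ} {n : ℕ}
    {s : Set E} (hs : IsOpen s) {C a : ℝ} (ha0 : 0 ≤ a) (ha1 : a < 1)
    (hG : ∀ j, ContDiff ℝ n (G j))
    (hk : ∀ k ≤ n, ∀ j, ∀ x ∈ s,
      ‖iteratedFDeriv ℝ k (G (j + 1)) x - iteratedFDeriv ℝ k (G j) x‖ ≤ C * a ^ j)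
    (hlim : ∀ x ∈ s, Tendsto (fun j => G j x) atTop (𝓝 (F x))) :
    ∃ p : E → FormalMultilinearSeries ℝ E ℝ, HasFTaylorSeriesUpToOn n F p s ∧
      ∀ x ∈ s, ∀ j, ‖iteratedFDeriv ℝ n (G j) x - p x n‖ ≤ C * a ^ j / (1 - a) := by
  have h : ∀ k, ∃ g : E → (E [×k]→L[ℝ] ℝ), k ≤ n → ∀ x ∈ s,
      Tendsto (fun j => iteratedFDeriv ℝ k (G j) x) atTop (𝓝 (g x)) ∧
        ∀ j, ‖iteratedFDeriv ℝ k (G j) x - g x‖ ≤ C * a ^ j / (1 - a) := by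
    intro k
    by_cases hkn : k ≤ n
    · obtain ⟨g, hg⟩ := exists_limit_of_norm_sub_le_geometric
        (u := fun j => iteratedFDeriv ℝ k (G j)) ha1 (hk k hkn)
      exact ⟨g, fun _ => hg⟩
    · exact ⟨0, fun h => absurd h hkn⟩
  choose g hg using h
  refine ⟨fun x k => g k x, ⟨fun x hx => ?_, fun m hm x hx => ?_, fun m hm => ?_⟩,
    fun x hx => (hg n le_rfl x hx).2⟩
  · have h1 := (continuousMultilinearCurryFin0 ℝ E ℝ).continuous.tendsto _ |>.comp
      (hg 0 (Nat.zero_le n) x hx).1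
    exact tendsto_nhds_unique h1 (by simpa [Function.comp_def] using hlim x hx)
  · have hm' : m < n := by exact_mod_cast hm
    refine (hasFDerivAt_of_tendstoUniformlyOn (l := atTop) hs
      (f := fun j => iteratedFDeriv ℝ m (G j))
      (f' := fun j y => (iteratedFDeriv ℝ (m + 1) (G j) y).curryLeft)
      (g' := fun y => (g (m + 1) y).curryLeft)
      ?_ (fun j y _ => ?_) (fun y hy => (hg m hm'.le y hy).1) hx).hasFDerivWithinAt
    · refine tendstoUniformlyOn_of_norm_sub_le_geometric (C := C) ha0 ha1 fun y hy j => ?_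
      have h2 := (hg (m + 1) hm' y hy).2 j
      rw [← norm_curryLeft_sub_curryLeft] at h2
      exact h2
    · exact ((hG j).differentiable_iteratedFDeriv (by exact_mod_cast hm') y).hasFDerivAt
  · have hm' : m ≤ n := by exact_mod_cast hm
    refine TendstoUniformlyOn.continuousOn (F := fun j => iteratedFDeriv ℝ m (G j)) (p := atTop)
      (tendstoUniformlyOn_of_norm_sub_le_geometric (C := C) ha0 ha1
        fun y hy => (hg m hm' y hy).2) ?_
    refine Frequently.of_forall fun j => ?_
    exact ((hG j).continuous_iteratedFDeriv (by exact_mod_cast hm')).continuousOn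

theorem norm_iteratedFDeriv_sub_sub_le {f g : E → ℝ} {n : ℕ} (hf : ContDiff ℝ (n + 1 : ℕ) f)
    (hg : ContDiff ℝ (n + 1 : ℕ) g) {s : Set E} (hs : Convex ℝ s) {B : ℝ}
    (hB : ∀ x ∈ s, ‖iteratedFDeriv ℝ (n + 1) f x - iteratedFDeriv ℝ (n + 1) g x‖ ≤ B)
    {x y : E} (hx : x ∈ s) (hy : y ∈ s) :
    ‖(iteratedFDeriv ℝ n f y - iteratedFDeriv ℝ n g y) -
      (iteratedFDeriv ℝ n f x - iteratedFDeriv ℝ n g x)‖ ≤ B * ‖y - x‖ := by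
  have hfd := hf.differentiable_iteratedFDeriv (m := n) (by exact_mod_cast Nat.lt_succ_self n)
  have hgd := hg.differentiable_iteratedFDeriv (m := n) (by exact_mod_cast Nat.lt_succ_self n)
  refine hs.norm_image_sub_le_of_norm_hasFDerivWithin_le
    (f := fun z => iteratedFDeriv ℝ n f z - iteratedFDeriv ℝ n g z)
    (f' := fun z => fderiv ℝ (iteratedFDeriv ℝ n f) z - fderiv ℝ (iteratedFDeriv ℝ n g) z)
    (fun z _ => ((hfd z).hasFDerivAt.sub (hgd z).hasFDerivAt).hasFDerivWithinAt)
    (fun z hz => ?_) hx hy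
  have h2 := hB z hz
  rw [← norm_curryLeft_sub_curryLeft] at h2
  exact h2

/-- A **Bernstein inverse theorem**: a limit of smooth functions whose consecutive differences
have geometrically controlled derivatives is `C^{n,α}`. -/
theorem contDiffOn_and_holderOnWith_of_dyadic {F : E → ℝ} {G : ℕ → E → ℝ} {n : ℕ} {α : NNReal}
    (hα0 : 0 < α) (hα1 : α < 1) {s : Set E} (hs : IsOpen s) (hconv : Convex ℝ s)
    (hdiam : ∀ x ∈ s, ∀ y ∈ s, ‖y - x‖ ≤ 1) {C a : ℝ} (hC : 0 ≤ C)
    (ha : a = (1 / 2 : ℝ) ^ (α : ℝ))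
    (hG : ∀ j, ContDiff ℝ (n + 1 : ℕ) (G j)) (h0 : G 0 = 0)
    (hk : ∀ k ≤ n, ∀ j, ∀ x ∈ s,
      ‖iteratedFDeriv ℝ k (G (j + 1)) x - iteratedFDeriv ℝ k (G j) x‖ ≤ C * a ^ j)
    (hn : ∀ j, ∀ x ∈ s, ‖iteratedFDeriv ℝ (n + 1) (G (j + 1)) x -
      iteratedFDeriv ℝ (n + 1) (G j) x‖ ≤ C * (2 * a) ^ j)
    (hlim : ∀ x ∈ s, Tendsto (fun j => G j x) atTop (𝓝 (F x))) :
    ContDiffOn ℝ n F s ∧ ∃ K : NNReal, HolderOnWith K α (iteratedFDeriv ℝ n F) s := by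
  have hα0' : (0 : ℝ) < α := by exact_mod_cast hα0
  have hα1' : (α : ℝ) < 1 := by exact_mod_cast hα1
  have ha0 : 0 < a := by rw [ha]; positivity
  have ha1 : a < 1 := by
    rw [ha]; exact Real.rpow_lt_one (by norm_num) (by norm_num) hα0'
  have ha2 : 1 < 2 * a := by
    have : (1 / 2 : ℝ) ^ (1 : ℝ) < (1 / 2 : ℝ) ^ (α : ℝ) :=
      Real.rpow_lt_rpow_of_exponent_gt (by norm_num) (by norm_num) hα1'
    rw [Real.rpow_one] at this
    rw [ha]; linarith
  have ha1' : 0 < 1 - a := by linarith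
  have ha2' : 0 < 2 * a - 1 := by linarith
  have hG' : ∀ j, ContDiff ℝ n (G j) := fun j =>
    (hG j).of_le (by exact_mod_cast Nat.le_succ n)
  obtain ⟨p, hp, hpn⟩ :=
    hasFTaylorSeriesUpToOn_of_norm_iteratedFDeriv_sub_le hs ha0.le ha1 hG' hk hlim
  have hF : ContDiffOn ℝ n F s := by
    have := HasFTaylorSeriesUpToOn.contDiffOn (n := (n : ℕ∞)) (by exact_mod_cast hp)
    exact_mod_cast this
  refine ⟨hF, ?_⟩
  have hpF : ∀ x ∈ s, p x n = iteratedFDeriv ℝ n F x := fun x hx => by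
    rw [hp.eq_iteratedFDerivWithin_of_uniqueDiffOn le_rfl hs.uniqueDiffOn hx,
      iteratedFDerivWithin_of_isOpen n hs hx]
  have hlip : ∀ J, ∀ x ∈ s, ∀ y ∈ s, ‖iteratedFDeriv ℝ n (G J) y - iteratedFDeriv ℝ n (G J) x‖ ≤
      C * (2 * a) ^ J / (2 * a - 1) * ‖y - x‖ := by
    intro J x hx y hy
    induction J with
    | zero =>
      rw [h0]
      have : iteratedFDeriv ℝ n (0 : E → ℝ) = 0 := iteratedFDeriv_fun_zero
      rw [this]
      simp only [Pi.zero_apply, sub_zero, norm_zero]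
      positivity
    | succ J ih =>
      have h1 := norm_iteratedFDeriv_sub_sub_le (hG (J + 1)) (hG J) hconv (hn J) hx hy
      calc _ = ‖((iteratedFDeriv ℝ n (G (J + 1)) y - iteratedFDeriv ℝ n (G J) y) -
            (iteratedFDeriv ℝ n (G (J + 1)) x - iteratedFDeriv ℝ n (G J) x)) +
            (iteratedFDeriv ℝ n (G J) y - iteratedFDeriv ℝ n (G J) x)‖ := by congr 1; abel
        _ ≤ C * (2 * a) ^ J * ‖y - x‖ + C * (2 * a) ^ J / (2 * a - 1) * ‖y - x‖ :=
            (norm_add_le _ _).trans (add_le_add h1 ih)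
        _ = _ := by field_simp; ring
  set K : ℝ := (2 * C / (1 - a) + C / (2 * a - 1)) * 2 ^ (α : ℝ) with hK
  have hK0 : 0 ≤ K := by positivity
  have main : ∀ x ∈ s, ∀ y ∈ s,
      ‖iteratedFDeriv ℝ n F y - iteratedFDeriv ℝ n F x‖ ≤ K * ‖y - x‖ ^ (α : ℝ) := by
    intro x hx y hy
    rcases eq_or_ne y x with rfl | hyx
    · simp only [sub_self, norm_zero]
      positivity
    have hpos : 0 < ‖y - x‖ := norm_pos_iff.mpr (sub_ne_zero.mpr hyx)
    obtain ⟨J, hJ1, hJ2⟩ := exists_nat_pow_near_of_lt_one hpos (hdiam x hx y hy)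
      (by norm_num : (0 : ℝ) < 1 / 2) (by norm_num)
    have h1 := hpn x hx J
    have h2 := hpn y hy J
    rw [hpF x hx] at h1
    rw [hpF y hy, norm_sub_rev] at h2
    have h3 := hlip J x hx y hy
    have h4 : (2 * a) ^ J * ‖y - x‖ ≤ a ^ J := by
      calc (2 * a) ^ J * ‖y - x‖ ≤ (2 * a) ^ J * (1 / 2) ^ J := by gcongr
        _ = a ^ J := by rw [← mul_pow]; congr 1; ring
    have h5 : a ^ J ≤ 2 ^ (α : ℝ) * ‖y - x‖ ^ (α : ℝ) := by
      rw [ha, ← Real.rpow_natCast, ← Real.rpow_mul (by norm_num), mul_comm (α : ℝ),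
        Real.rpow_mul (by norm_num), Real.rpow_natCast, ← Real.mul_rpow (by norm_num) hpos.le]
      refine Real.rpow_le_rpow (by positivity) ?_ hα0'.le
      rw [pow_succ] at hJ1
      linarith
    calc _ = ‖(iteratedFDeriv ℝ n F y - iteratedFDeriv ℝ n (G J) y) +
          (iteratedFDeriv ℝ n (G J) y - iteratedFDeriv ℝ n (G J) x) +
          (iteratedFDeriv ℝ n (G J) x - iteratedFDeriv ℝ n F x)‖ := by congr 1; abel
      _ ≤ C * a ^ J / (1 - a) + C * (2 * a) ^ J / (2 * a - 1) * ‖y - x‖ +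
          C * a ^ J / (1 - a) := (norm_add₃_le).trans (by gcongr)
      _ = 2 * C / (1 - a) * a ^ J + C / (2 * a - 1) * ((2 * a) ^ J * ‖y - x‖) := by ring
      _ ≤ 2 * C / (1 - a) * a ^ J + C / (2 * a - 1) * a ^ J := by gcongr
      _ = (2 * C / (1 - a) + C / (2 * a - 1)) * a ^ J := by ring
      _ ≤ (2 * C / (1 - a) + C / (2 * a - 1)) * (2 ^ (α : ℝ) * ‖y - x‖ ^ (α : ℝ)) := by gcongr
      _ = _ := by rw [hK]; ring
  refine ⟨K.toNNReal, fun x hx y hy => ?_⟩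
  rw [edist_dist, edist_dist, dist_comm, dist_comm x, dist_eq_norm, dist_eq_norm,
    ENNReal.ofReal_rpow_of_nonneg (norm_nonneg _) hα0'.le]
  refine le_trans ?_ (ENNReal.ofReal_mul hK0).le
  exact ENNReal.ofReal_le_ofReal (main x hx y hy)

end DyadicLimit

section FiniteDifference

theorem exists_holder_of_isCompact {X V : Type*} [NormedAddCommGroup X]
    [SeminormedAddCommGroup V] {α : NNReal}
    {g : X → V} (hg : ∀ x, ∃ C : NNReal, ∃ s ∈ nhds x, HolderOnWith C α g s)
    {K : Set X} (hK : IsCompact K) :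
    ∃ C δ : ℝ, 0 ≤ C ∧ 0 < δ ∧ ∀ x ∈ K, ∀ y, ‖y - x‖ ≤ δ →
      ‖g y - g x‖ ≤ C * ‖y - x‖ ^ (α : ℝ) := by
  refine hK.induction_on (p := fun K => ∃ C δ : ℝ, 0 ≤ C ∧ 0 < δ ∧ ∀ x ∈ K, ∀ y, ‖y - x‖ ≤ δ →
      ‖g y - g x‖ ≤ C * ‖y - x‖ ^ (α : ℝ)) ⟨0, 1, by simp⟩ ?_ ?_ ?_
  · rintro s t hst ⟨C, δ, hC, hδ, h⟩
    exact ⟨C, δ, hC, hδ, fun x hx => h x (hst hx)⟩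
  · rintro s t ⟨C, δ, hC, hδ, h⟩ ⟨C', δ', hC', hδ', h'⟩
    refine ⟨max C C', min δ δ', le_max_of_le_left hC, lt_min hδ hδ', ?_⟩
    rintro x (hx | hx) y hy
    · refine (h x hx y (hy.trans (min_le_left _ _))).trans ?_
      gcongr
      exact le_max_left _ _
    · refine (h' x hx y (hy.trans (min_le_right _ _))).trans ?_
      gcongr
      exact le_max_right _ _
  · intro x _
    obtain ⟨C, s, hs, h⟩ := hg x
    obtain ⟨ε, hε, hball⟩ := Metric.mem_nhds_iff.1 hs
    refine ⟨Metric.ball x (ε / 2),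
      mem_nhdsWithin_of_mem_nhds (Metric.ball_mem_nhds _ (by linarith)),
      C, ε / 4, C.2, by linarith, ?_⟩
    intro z hz y hy
    have hz' : z ∈ s := hball (Metric.ball_subset_ball (by linarith) hz)
    have hy' : y ∈ s := by
      apply hball
      rw [Metric.mem_ball] at hz ⊢
      have := dist_triangle y z x
      rw [dist_eq_norm y z] at this
      linarith
    have := h.dist_le hy' hz'
    rwa [dist_eq_norm, dist_eq_norm] at this

variable {E : Type*} [NormedAddCommGroup E] [NormedSpace ℝ E]

theorem exists_fwdDiff_iter_eq_iteratedFDeriv {n : ℕ} {f : E → ℝ} (hf : ContDiff ℝ n f) (x t : E) :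
    ∃ ξ ∈ Set.Icc (0 : ℝ) n,
      (fwdDiff t)^[n] f x = iteratedFDeriv ℝ n f (x + ξ • t) (fun _ => t) := by
  induction n generalizing f x with
  | zero => exact ⟨0, by simp, by simp⟩
  | succ n ih =>
    have hfn : ContDiff ℝ n f := hf.of_le (by exact_mod_cast Nat.le_succ n)
    have hshift : ContDiff ℝ n (fun y => f (y + t)) := hfn.comp (contDiff_id.add contDiff_const)
    have hΔ : ContDiff ℝ n (fwdDiff t f) := hshift.sub hfn
    obtain ⟨ξ, hξ, h⟩ := ih hΔ x
    have hdiff : Differentiable ℝ (iteratedFDeriv ℝ n f) :=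
      hf.differentiable_iteratedFDeriv (by exact_mod_cast Nat.lt_succ_self n)
    let φ : ℝ → ℝ := fun s => iteratedFDeriv ℝ n f (x + ξ • t + s • t) (fun _ => t)
    have hφ (s : ℝ) : HasDerivAt φ
        (iteratedFDeriv ℝ (n + 1) f (x + ξ • t + s • t) (fun _ => t)) s := by
      have hline : HasDerivAt (fun s : ℝ => x + ξ • t + s • t) t s := by
        simpa using ((hasDerivAt_id s).smul_const t).const_add (x + ξ • t)
      have h1 := (hdiff (x + ξ • t + s • t)).hasFDerivAt.comp_hasDerivAt s hline
      have h2 := (ContinuousMultilinearMap.apply ℝ (fun _ : Fin n => E) ℝ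
        (fun _ => t)).hasFDerivAt.comp_hasDerivAt s h1
      rw [iteratedFDeriv_succ_apply_left]
      exact h2
    obtain ⟨c, hc, hc'⟩ := exists_hasDerivAt_eq_slope φ _ zero_lt_one
      (fun s _ => (hφ s).continuousAt.continuousWithinAt) (fun s _ => hφ s)
    refine ⟨ξ + c, ⟨by linarith [hξ.1, hc.1], by push_cast; linarith [hξ.2, hc.2]⟩, ?_⟩
    have hsub : iteratedFDeriv ℝ n (fwdDiff t f) (x + ξ • t) =
        iteratedFDeriv ℝ n f (x + ξ • t + t) - iteratedFDeriv ℝ n f (x + ξ • t) := by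
      have := iteratedFDeriv_sub_apply (x := x + ξ • t) (i := n) hshift.contDiffAt hfn.contDiffAt
      rw [iteratedFDeriv_comp_add_right] at this
      exact this
    rw [Function.iterate_succ_apply, h, hsub, add_smul, ← add_assoc, hc']
    simp [φ]

theorem abs_fwdDiff_iter_succ_le {n : ℕ} {f : E → ℝ} (hf : ContDiff ℝ n f) (x t : E) :
    ∃ ξ ∈ Set.Icc (0 : ℝ) n, |(fwdDiff t)^[n + 1] f x| ≤
      ‖iteratedFDeriv ℝ n f (x + ξ • t + t) - iteratedFDeriv ℝ n f (x + ξ • t)‖ * ‖t‖ ^ n := by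
  have hshift : ContDiff ℝ n (fun y => f (y + t)) := hf.comp (contDiff_id.add contDiff_const)
  obtain ⟨ξ, hξ, h⟩ := exists_fwdDiff_iter_eq_iteratedFDeriv (hshift.sub hf) x t
  refine ⟨ξ, hξ, ?_⟩
  have hsub : iteratedFDeriv ℝ n (fun y => f (y + t) - f y) (x + ξ • t) =
      iteratedFDeriv ℝ n f (x + ξ • t + t) - iteratedFDeriv ℝ n f (x + ξ • t) := by
    have := iteratedFDeriv_sub_apply (x := x + ξ • t) (i := n) hshift.contDiffAt hf.contDiffAt
    rw [iteratedFDeriv_comp_add_right] at this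
    exact this
  have hΔ : fwdDiff t f = fun y => f (y + t) - f y := rfl
  rw [Function.iterate_succ_apply, hΔ, h, hsub, ← Real.norm_eq_abs]
  refine (ContinuousMultilinearMap.le_opNorm _ _).trans_eq ?_
  simp

theorem exists_abs_fwdDiff_iter_le [ProperSpace E] {n : ℕ} {α : NNReal} {f : E → ℝ}
    (hf : ContDiff ℝ n f)
    (hα : ∀ x, ∃ C : NNReal, ∃ s ∈ nhds x, HolderOnWith C α (iteratedFDeriv ℝ n f) s) (R : ℝ) :
    ∃ C δ : ℝ, 0 ≤ C ∧ 0 < δ ∧ δ ≤ 1 ∧ ∀ x ∈ Metric.closedBall (0 : E) R, ∀ t, ‖t‖ ≤ δ →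
      |(fwdDiff t)^[n + 1] f x| ≤ C * ‖t‖ ^ (n + α : ℝ) := by
  obtain ⟨C, δ, hC, hδ, h⟩ := exists_holder_of_isCompact hα
    (isCompact_closedBall (0 : E) (R + n))
  refine ⟨C, min δ 1, hC, lt_min hδ one_pos, min_le_right _ _, ?_⟩
  intro x hx t ht
  obtain ⟨ξ, hξ, hle⟩ := abs_fwdDiff_iter_succ_le hf x t
  have hmem : x + ξ • t ∈ Metric.closedBall (0 : E) (R + n) := by
    rw [mem_closedBall_zero_iff] at hx ⊢
    refine (norm_add_le _ _).trans (add_le_add hx ?_)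
    rw [norm_smul, Real.norm_eq_abs, abs_of_nonneg hξ.1]
    exact (mul_le_mul hξ.2 (ht.trans (min_le_right _ _)) (norm_nonneg _) (by positivity)).trans_eq
      (mul_one _)
  have h1 := h _ hmem (x + ξ • t + t) (by simpa using ht.trans (min_le_left _ _))
  rw [add_sub_cancel_left] at h1
  refine hle.trans ((mul_le_mul_of_nonneg_right h1 (by positivity)).trans_eq ?_)
  rw [mul_assoc, add_comm (n : ℝ),
    Real.rpow_add_of_nonneg (norm_nonneg _) α.coe_nonneg (Nat.cast_nonneg _),
    Real.rpow_natCast]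

end FiniteDifference

section PolynomialIntegral

open MeasureTheory

theorem MvPolynomial.totalDegree_eval₂_C_comp_le {σ τ R S : Type*} [CommSemiring R]
    [CommSemiring S] (φ : R →+* S) (g : σ → MvPolynomial τ S) {e : ℕ}
    (hg : ∀ i, (g i).totalDegree ≤ e) (P : MvPolynomial σ R) :
    (P.eval₂ (MvPolynomial.C.comp φ) g).totalDegree ≤ P.totalDegree * e := by
  rw [MvPolynomial.eval₂_eq]
  refine MvPolynomial.totalDegree_finsetSum_le fun m hm => ?_
  refine (MvPolynomial.totalDegree_mul _ _).trans ?_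
  rw [RingHom.comp_apply, MvPolynomial.totalDegree_C, zero_add]
  refine (MvPolynomial.totalDegree_finsetProd _ _).trans ?_
  calc ∑ i ∈ m.support, (g i ^ m i).totalDegree ≤ ∑ i ∈ m.support, m i * e :=
        Finset.sum_le_sum fun i _ => (MvPolynomial.totalDegree_pow _ _).trans
          (Nat.mul_le_mul_left _ (hg i))
    _ = (m.sum fun _ k => k) * e := by rw [Finsupp.sum, Finset.sum_mul]
    _ ≤ P.totalDegree * e := Nat.mul_le_mul_right _ (MvPolynomial.le_totalDegree hm)

theorem MvPolynomial.exists_eval_eq_integral {σ Y : Type*} [MeasurableSpace Y] (μ : Measure Y)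
    (g : Y → ℝ) (v : Y → σ → ℝ)
    (hinteg : ∀ Q : MvPolynomial σ ℝ, Integrable (fun y => g y * MvPolynomial.eval (v y) Q) μ)
    (K : MvPolynomial σ ℝ) (c : ℝ) :
    ∃ Q : MvPolynomial σ ℝ, Q.totalDegree ≤ K.totalDegree ∧
      ∀ x : σ → ℝ, MvPolynomial.eval x Q =
        ∫ y, g y * MvPolynomial.eval (fun i => c * (v y i - x i)) K ∂μ := by
  let T : MvPolynomial σ (MvPolynomial σ ℝ) :=
    K.eval₂ (MvPolynomial.C.comp MvPolynomial.C)
      fun i => MvPolynomial.C (MvPolynomial.C c) *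
        (MvPolynomial.C (MvPolynomial.X i) - MvPolynomial.X i)
  have hT : T.totalDegree ≤ K.totalDegree := by
    refine (MvPolynomial.totalDegree_eval₂_C_comp_le _ _ (e := 1) (fun i => ?_) K).trans_eq
      (mul_one _)
    refine (MvPolynomial.totalDegree_mul _ _).trans ?_
    rw [MvPolynomial.totalDegree_C, zero_add]
    refine (MvPolynomial.totalDegree_sub _ _).trans (max_le ?_ ?_)
    · simp
    · simp
  have hval (x : σ → ℝ) (y : Y) : MvPolynomial.eval (fun i => c * (v y i - x i)) K =
      ∑ m ∈ T.support, MvPolynomial.eval (v y) (T.coeff m) * ∏ i ∈ m.support, x i ^ m i := by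
    have h1 : MvPolynomial.eval₂ (MvPolynomial.eval (v y)) x T =
        MvPolynomial.eval (fun i => c * (v y i - x i)) K := by
      have h2 := MvPolynomial.hom_eval₂ K (MvPolynomial.C.comp MvPolynomial.C)
        (MvPolynomial.eval₂Hom (MvPolynomial.eval (v y)) x)
        fun i => MvPolynomial.C (MvPolynomial.C c) *
          (MvPolynomial.C (MvPolynomial.X i) - MvPolynomial.X i)
      rw [MvPolynomial.coe_eval₂Hom] at h2
      refine h2.trans ?_
      rw [← MvPolynomial.eval₂_id]
      congr 1
      · ext; simp
      · ext; simp
    rw [← h1, MvPolynomial.eval₂_eq]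
  refine ⟨∑ m ∈ T.support, MvPolynomial.monomial m
    (∫ y, g y * MvPolynomial.eval (v y) (T.coeff m) ∂μ), ?_, fun x => ?_⟩
  · refine MvPolynomial.totalDegree_finsetSum_le fun m hm => ?_
    exact (MvPolynomial.totalDegree_monomial_le _ _).trans
      ((MvPolynomial.le_totalDegree hm).trans hT)
  · simp_rw [hval x, Finset.mul_sum, ← mul_assoc]
    rw [integral_finsetSum _ fun m _ => (hinteg _).mul_const _, map_sum]
    refine Finset.sum_congr rfl fun m _ => ?_
    rw [MvPolynomial.eval_monomial, integral_mul_const, Finsupp.prod]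

end PolynomialIntegral

section FejerKernel

open MeasureTheory Polynomial

theorem Real.abs_sin_natCast_mul_le (N : ℕ) (θ : ℝ) : |Real.sin (N * θ)| ≤ N * |Real.sin θ| := by
  induction N with
  | zero => simp
  | succ N ih =>
    have h : Real.sin ((N + 1 : ℕ) * θ) =
        Real.sin (N * θ) * Real.cos θ + Real.cos (N * θ) * Real.sin θ := by
      rw [← Real.sin_add]
      push_cast
      ring_nf
    rw [h]
    refine (abs_add_le _ _).trans ?_
    rw [abs_mul, abs_mul]
    have h1 := mul_le_mul_of_nonneg_left (Real.abs_cos_le_one θ) (abs_nonneg (Real.sin (N * θ)))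
    have h2 := mul_le_mul_of_nonneg_right (Real.abs_cos_le_one (N * θ)) (abs_nonneg (Real.sin θ))
    push_cast
    linarith

theorem exists_polynomial_mul_eq_sin_sq (N : ℕ) :
    ∃ r : ℝ[X], r.natDegree ≤ N ∧
      ∀ θ : ℝ, Real.sin θ ^ 2 * r.eval (Real.sin θ ^ 2) = Real.sin (N * θ) ^ 2 := by
  let A : ℝ[X] := C (1 / 2) * (1 - (Chebyshev.T ℝ N).comp (1 - C 2 * X))
  have hA (θ : ℝ) : A.eval (Real.sin θ ^ 2) = Real.sin (N * θ) ^ 2 := by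
    have h : 1 - 2 * Real.sin θ ^ 2 = Real.cos (2 * θ) := by
      rw [Real.cos_two_mul, Real.sin_sq]
      ring
    have h' : (Chebyshev.T ℝ N).eval (Real.cos (2 * θ)) = Real.cos (2 * (N * θ)) := by
      rw [Chebyshev.T_real_cos]
      push_cast
      ring_nf
    simp only [A, eval_mul, eval_C, eval_sub, eval_one, eval_comp, eval_X, h, h']
    rw [Real.cos_two_mul, Real.sin_sq]
    ring
  have hA0 : A.coeff 0 = 0 := by
    have := hA 0
    simpa [coeff_zero_eq_eval_zero] using this
  refine ⟨A.divX, ?_, fun θ => ?_⟩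
  · refine natDegree_divX_le.trans ?_
    refine (natDegree_C_mul_le _ _).trans ?_
    refine (natDegree_sub_le _ _).trans (max_le (by simp) ?_)
    refine natDegree_comp_le.trans ?_
    have h1 : (1 - C 2 * X : ℝ[X]).natDegree ≤ 1 :=
      (natDegree_sub_le _ _).trans (max_le (by simp)
        ((natDegree_C_mul_le _ _).trans natDegree_X_le))
    rw [Chebyshev.natDegree_T, Int.natAbs_natCast]
    exact (Nat.mul_le_mul_left _ h1).trans_eq (mul_one _)
  · have h := congrArg (eval (Real.sin θ ^ 2)) (X_mul_divX_add A)
    rw [hA0, C_0, add_zero, eval_mul, eval_X, hA] at h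
    exact h

theorem exists_fejer_polynomial {N : ℕ} (hN : 0 < N) :
    ∃ r : ℝ[X], r.natDegree ≤ N ∧ ∀ u ∈ Set.Icc (0 : ℝ) 1, 0 ≤ r.eval u ∧
      r.eval u * (1 + N ^ 2 * u) ≤ 2 ∧ (N ^ 2 * u ≤ 1 → 1 / 4 ≤ r.eval u) := by
  obtain ⟨r, hdeg, hr⟩ := exists_polynomial_mul_eq_sin_sq N
  have hN' : (0 : ℝ) < N := by exact_mod_cast hN
  have hNN : (0 : ℝ) < (N : ℝ) ^ 2 := by positivity
  have key : ∀ u ∈ Set.Ioc (0 : ℝ) 1, 0 ≤ r.eval u ∧ r.eval u ≤ N ^ 2 ∧ u * r.eval u ≤ 1 ∧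
      (N ^ 2 * u ≤ 1 → N ^ 2 / 4 ≤ r.eval u) := by
    intro u hu
    set s := √u with hs
    have hs0 : 0 < s := Real.sqrt_pos.2 hu.1
    have hs1 : s ≤ 1 := Real.sqrt_le_one.2 hu.2
    have hsu : s ^ 2 = u := Real.sq_sqrt hu.1.le
    set θ := Real.arcsin s with hθ
    have hsin : Real.sin θ = s := Real.sin_arcsin (by linarith) hs1
    have hθ0 : 0 ≤ θ := Real.arcsin_nonneg.2 hs0.le
    have hθ1 : θ ≤ Real.pi / 2 := Real.arcsin_le_pi_div_two s
    have hru := hr θ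
    rw [hsin, hsu] at hru
    have hpos : 0 ≤ r.eval u := by
      by_contra hcon
      push Not at hcon
      have := mul_neg_of_pos_of_neg hu.1 hcon
      nlinarith [sq_nonneg (Real.sin (N * θ))]
    refine ⟨hpos, ?_, ?_, fun hle => ?_⟩
    · have h1 := Real.abs_sin_natCast_mul_le N θ
      rw [hsin, abs_of_pos hs0] at h1
      have h2 : Real.sin (N * θ) ^ 2 ≤ (N * s) ^ 2 := by
        rw [← sq_abs]
        gcongr
      rw [← hru, mul_pow, hsu, mul_comm _ u] at h2
      exact le_of_mul_le_mul_left h2 hu.1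
    · rw [hru]
      exact Real.sin_sq_le_one _
    · have hNs : N * s ≤ 1 := by
        have : (N * s) ^ 2 ≤ 1 := by rwa [mul_pow, hsu]
        exact (sq_le_one_iff₀ (by positivity)).1 this
      have hπ := Real.pi_pos
      have h1 : 2 / Real.pi * θ ≤ s := by
        rw [← hsin]
        exact Real.mul_le_sin hθ0 hθ1
      have h2 : N * θ ≤ Real.pi / 2 := by
        have h3 : N * (2 / Real.pi * θ) ≤ 1 :=
          (mul_le_mul_of_nonneg_left h1 hN'.le).trans hNs
        have h4 : N * (2 / Real.pi * θ) * (Real.pi / 2) = N * θ := by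
          field_simp
        nlinarith
      have h3 : 2 / Real.pi * (N * θ) ≤ Real.sin (N * θ) := Real.mul_le_sin (by positivity) h2
      have h4 : s ≤ θ := hsin ▸ Real.sin_le hθ0
      have h5 : 1 / 2 ≤ 2 / Real.pi := by
        rw [div_le_div_iff₀ (by norm_num) hπ]
        linarith [Real.pi_le_four]
      have h6 : 1 / 2 * (N * s) ≤ Real.sin (N * θ) :=
        (mul_le_mul h5 (by gcongr) (by positivity) (by positivity)).trans h3
      have h7 : (1 / 2 * (N * s)) ^ 2 ≤ Real.sin (N * θ) ^ 2 := by gcongr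
      rw [← hru, mul_pow, mul_pow, hsu] at h7
      exact le_of_mul_le_mul_left (by linarith) hu.1
  have hev : ∀ᶠ u in nhdsWithin (0 : ℝ) (Set.Ioi 0), u ∈ Set.Ioc (0 : ℝ) 1 :=
    Ioc_mem_nhdsGT one_pos
  have hev' : ∀ᶠ u in nhdsWithin (0 : ℝ) (Set.Ioi 0), u ∈ Set.Ioc (0 : ℝ) (1 / N ^ 2) :=
    Ioc_mem_nhdsGT (by positivity)
  have hlim : Filter.Tendsto (fun u => r.eval u) (nhdsWithin 0 (Set.Ioi 0)) (nhds (r.eval 0)) :=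
    r.continuous.continuousAt.continuousWithinAt
  have key0 : ∀ u ∈ Set.Icc (0 : ℝ) 1, 0 ≤ r.eval u ∧ r.eval u ≤ N ^ 2 ∧ u * r.eval u ≤ 1 ∧
      (N ^ 2 * u ≤ 1 → N ^ 2 / 4 ≤ r.eval u) := by
    intro u hu
    rcases hu.1.eq_or_lt with rfl | hpos
    · refine ⟨ge_of_tendsto hlim (hev.mono fun u hu => (key u hu).1),
        le_of_tendsto hlim (hev.mono fun u hu => (key u hu).2.1), by simp, fun _ => ?_⟩
      refine ge_of_tendsto hlim ((hev.and hev').mono fun u hu => (key u hu.1).2.2.2 ?_)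
      have := mul_le_mul_of_nonneg_left hu.2.2 hNN.le
      rwa [mul_one_div_cancel hNN.ne'] at this
    · exact key u ⟨hpos, hu.2⟩
  refine ⟨C (1 / (N : ℝ) ^ 2) * r, (natDegree_C_mul_le _ _).trans hdeg, fun u hu => ?_⟩
  obtain ⟨h0, h1, h2, h3⟩ := key0 u hu
  rw [eval_mul, eval_C]
  refine ⟨by positivity, ?_, fun hle => ?_⟩
  · have : 1 / (N : ℝ) ^ 2 * r.eval u * (1 + N ^ 2 * u) =
        r.eval u / N ^ 2 + u * r.eval u := by
      field_simp
    rw [this]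
    have := (div_le_one hNN).2 h1
    linarith
  · have := h3 hle
    rw [one_div_mul_eq_div, le_div_iff₀ hNN]
    linarith

end FejerKernel

section JacksonKernel

open MeasureTheory

theorem continuous_eval_ofLp {d : ℕ} (W : MvPolynomial (Fin d) ℝ) :
    Continuous fun t : EuclideanSpace ℝ (Fin d) => MvPolynomial.eval t.ofLp W :=
  (MvPolynomial.continuous_eval W).comp (PiLp.continuous_ofLp 2 _)

theorem MvPolynomial.totalDegree_polynomialAeval_le {σ : Type*} (q : MvPolynomial σ ℝ)
    (r : Polynomial ℝ) :
    (Polynomial.aeval q r).totalDegree ≤ r.natDegree * q.totalDegree := by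
  rw [Polynomial.aeval_eq_sum_range]
  refine MvPolynomial.totalDegree_finsetSum_le fun i hi => ?_
  refine (MvPolynomial.totalDegree_smul_le _ _).trans ((MvPolynomial.totalDegree_pow _ _).trans ?_)
  exact Nat.mul_le_mul_right _ (Nat.lt_succ_iff.1 (Finset.mem_range.1 hi))

theorem exists_radial_mvPolynomial (d : ℕ) {L : ℝ} (hL : 0 < L) {N : ℕ} (hN : 0 < N) :
    ∃ w : MvPolynomial (Fin d) ℝ, w.totalDegree ≤ N * 2 ∧
      ∀ t : EuclideanSpace ℝ (Fin d), ‖t‖ ≤ L → 0 ≤ MvPolynomial.eval t.ofLp w ∧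
        MvPolynomial.eval t.ofLp w * (1 + ‖((N / L : ℝ)) • t‖ ^ 2) ≤ 2 ∧
        (‖t‖ ≤ L / N → 1 / 4 ≤ MvPolynomial.eval t.ofLp w) := by
  obtain ⟨r, hdeg, hr⟩ := exists_fejer_polynomial hN
  let q : MvPolynomial (Fin d) ℝ := MvPolynomial.C (1 / L ^ 2) * ∑ i, MvPolynomial.X i ^ 2
  have hq : q.totalDegree ≤ 2 := by
    refine (MvPolynomial.totalDegree_mul _ _).trans ?_
    rw [MvPolynomial.totalDegree_C, zero_add]
    refine MvPolynomial.totalDegree_finsetSum_le fun i _ => ?_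
    exact (MvPolynomial.totalDegree_pow _ _).trans (by simp)
  have hN' : (0 : ℝ) < N := by exact_mod_cast hN
  refine ⟨Polynomial.aeval q r,
    (MvPolynomial.totalDegree_polynomialAeval_le q r).trans (Nat.mul_le_mul hdeg hq),
    fun t ht => ?_⟩
  have hqt : MvPolynomial.eval t.ofLp q = (‖t‖ / L) ^ 2 := by
    simp only [q, map_mul, MvPolynomial.eval_C, map_sum, map_pow, MvPolynomial.eval_X]
    rw [div_pow, EuclideanSpace.real_norm_sq_eq]
    ring
  have hev : MvPolynomial.eval t.ofLp (Polynomial.aeval q r) = r.eval ((‖t‖ / L) ^ 2) := by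
    rw [Polynomial.aeval_def, Polynomial.hom_eval₂, hqt, Polynomial.eval,
      show (MvPolynomial.eval t.ofLp).comp (algebraMap ℝ (MvPolynomial (Fin d) ℝ)) =
        RingHom.id ℝ from RingHom.ext fun x => by simp [MvPolynomial.algebraMap_eq]]
  have hle : ‖t‖ / L ≤ 1 := (div_le_one hL).2 ht
  have h0 : 0 ≤ ‖t‖ / L := by positivity
  obtain ⟨h1, h2, h3⟩ := hr ((‖t‖ / L) ^ 2) ⟨by positivity, pow_le_one₀ h0 hle⟩
  rw [hev]
  refine ⟨h1, ?_, fun htN => h3 ?_⟩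
  · rw [norm_smul, Real.norm_eq_abs, abs_of_pos (by positivity)]
    convert h2 using 3
    ring
  · rw [← mul_pow]
    refine pow_le_one₀ (by positivity) ?_
    rw [le_div_iff₀ hN'] at htN
    rw [mul_div_assoc', div_le_one hL]
    linarith

theorem exists_jackson_kernel (d : ℕ) {β L : ℝ} (hβ : 0 < β) (hL : 0 < L) :
    ∃ (C : ℝ) (D : ℕ), 0 ≤ C ∧ ∀ N : ℕ, 0 < N → ∃ W : MvPolynomial (Fin d) ℝ,
      W.totalDegree ≤ D * N ∧
      (∀ t ∈ Metric.closedBall (0 : EuclideanSpace ℝ (Fin d)) L,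
        0 ≤ MvPolynomial.eval t.ofLp W) ∧
      ∫ t in Metric.closedBall (0 : EuclideanSpace ℝ (Fin d)) L,
        MvPolynomial.eval t.ofLp W = 1 ∧
      ∫ t in Metric.closedBall (0 : EuclideanSpace ℝ (Fin d)) L,
        ‖t‖ ^ β * MvPolynomial.eval t.ofLp W ≤ C * (N : ℝ) ^ (-β) := by
  obtain ⟨l, hl⟩ := exists_nat_gt ((d + β) / 2)
  have hl' : (d : ℝ) < 2 * l - β := by linarith
  let E := EuclideanSpace ℝ (Fin d)
  let J : ℝ := ∫ x : E, (1 + ‖x‖ ^ 2) ^ (-(2 * l - β) / 2)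
  let V : ℝ := volume.real (Metric.closedBall (0 : E) 1)
  have hV : 0 < V := by
    refine ENNReal.toReal_pos (Metric.measure_closedBall_pos volume _ one_pos).ne' ?_
    exact measure_closedBall_lt_top.ne
  have hJint : Integrable fun x : E => (1 + ‖x‖ ^ 2) ^ (-(2 * l - β) / 2) :=
    integrable_rpow_neg_one_add_norm_sq (by simpa [E] using hl')
  have hJ : 0 ≤ J := integral_nonneg fun x => by positivity
  refine ⟨L ^ β * 8 ^ l * J / V, 2 * l, by positivity, fun N hN => ?_⟩
  have hN' : (0 : ℝ) < N := by exact_mod_cast hN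
  obtain ⟨w, hdeg, hw⟩ := exists_radial_mvPolynomial d hL hN
  set a : ℝ := N / L with ha
  have ha0 : 0 < a := by positivity
  let B := Metric.closedBall (0 : E) L
  have hB : MeasurableSet B := measurableSet_closedBall
  let φ : E → ℝ := fun t => MvPolynomial.eval t.ofLp w
  have hφ : Continuous φ := continuous_eval_ofLp w
  have hφB (t : E) (ht : t ∈ B) := hw t (mem_closedBall_zero_iff.1 ht)
  have hinteg {g : E → ℝ} (hg : Continuous g) : IntegrableOn g B :=
    hg.continuousOn.integrableOn_compact (isCompact_closedBall _ _)
  let I : ℝ := ∫ t in B, φ t ^ l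
  have hlower : (1 / 4) ^ l * ((1 / a) ^ d * V) ≤ I := by
    have hLN : L / N = 1 / a := by rw [ha, one_div_div]
    have hsub : Metric.closedBall (0 : E) (1 / a) ⊆ B := by
      apply Metric.closedBall_subset_closedBall
      rw [← hLN]
      exact div_le_self hL.le (by exact_mod_cast hN)
    calc (1 / 4) ^ l * ((1 / a) ^ d * V)
        = ∫ t in Metric.closedBall (0 : E) (1 / a), (1 / 4 : ℝ) ^ l := by
          rw [setIntegral_const, Measure.addHaar_real_closedBall' _ _ (by positivity)]
          simp [V, E, mul_comm]
      _ ≤ ∫ t in Metric.closedBall (0 : E) (1 / a), φ t ^ l := by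
          refine setIntegral_mono_on (integrableOn_const measure_closedBall_lt_top.ne)
            ((hinteg (hφ.pow l)).mono_set hsub) measurableSet_closedBall fun t ht => ?_
          refine pow_le_pow_left₀ (by norm_num) ((hφB t (hsub ht)).2.2 ?_) l
          rw [hLN]
          exact mem_closedBall_zero_iff.1 ht
      _ ≤ I := by
          refine setIntegral_mono_set (hinteg (hφ.pow l)) ?_ hsub.eventuallyLE
          filter_upwards [ae_restrict_mem hB] with t ht
          exact pow_nonneg (hφB t ht).1 l
  have hI : 0 < I := lt_of_lt_of_le (by positivity) hlower
  have hupper : ∫ t in B, ‖t‖ ^ β * φ t ^ l ≤ a ^ (-β) * 2 ^ l * ((1 / a) ^ d * J) := by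
    have hscale : ∫ t : E, (1 + ‖a • t‖ ^ 2) ^ (-(2 * l - β) / 2) = (1 / a) ^ d * J := by
      rw [Measure.integral_comp_smul volume (fun x : E => (1 + ‖x‖ ^ 2) ^ (-(2 * l - β) / 2)) a]
      simp [J, E, abs_of_pos ha0]
    have hsint : Integrable fun t : E => (1 + ‖a • t‖ ^ 2) ^ (-(2 * l - β) / 2) :=
      (integrable_comp_smul_iff volume (fun x : E => (1 + ‖x‖ ^ 2) ^ (-(2 * l - β) / 2))
        ha0.ne').2 hJint
    rw [← hscale, ← integral_const_mul]
    refine (setIntegral_mono_on (hinteg ?_) (hsint.const_mul _).integrableOn hB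
      fun t ht => ?_).trans (setIntegral_le_integral (hsint.const_mul _)
        (Filter.Eventually.of_forall fun t => by positivity))
    · exact (continuous_norm.rpow_const fun _ => Or.inr hβ.le).mul (hφ.pow l)
    · obtain ⟨h0, h1, -⟩ := hφB t ht
      set y : ℝ := 1 + ‖a • t‖ ^ 2 with hy
      have hy0 : 0 < y := by positivity
      have h2 : φ t ^ l ≤ 2 ^ l * y ^ (-(l : ℝ)) := by
        rw [Real.rpow_neg hy0.le, Real.rpow_natCast, ← div_eq_mul_inv, ← div_pow]
        exact pow_le_pow_left₀ h0 ((le_div_iff₀ hy0).2 h1) l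
      have h3 : ‖t‖ ^ β ≤ a ^ (-β) * y ^ (β / 2) := by
        have h4 : ‖t‖ = a⁻¹ * ‖a • t‖ := by
          rw [norm_smul, Real.norm_eq_abs, abs_of_pos ha0, inv_mul_cancel_left₀ ha0.ne']
        rw [h4, Real.mul_rpow (by positivity) (norm_nonneg _), Real.inv_rpow ha0.le,
          ← Real.rpow_neg ha0.le]
        gcongr
        have h5 : ‖a • t‖ ^ β = (‖a • t‖ ^ 2) ^ (β / 2) := by
          rw [← Real.rpow_natCast, ← Real.rpow_mul (norm_nonneg _)]
          congr 1
          push_cast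
          ring
        rw [h5]
        exact Real.rpow_le_rpow (by positivity) (by simp [hy]) (by positivity)
      calc ‖t‖ ^ β * φ t ^ l ≤ (a ^ (-β) * y ^ (β / 2)) * (2 ^ l * y ^ (-(l : ℝ))) :=
            mul_le_mul h3 h2 (pow_nonneg h0 l) (by positivity)
        _ = a ^ (-β) * 2 ^ l * (y ^ (β / 2) * y ^ (-(l : ℝ))) := by ring
        _ = a ^ (-β) * 2 ^ l * y ^ (-(2 * l - β) / 2) := by
            rw [← Real.rpow_add hy0]
            congr 2
            ring
  refine ⟨MvPolynomial.C I⁻¹ * w ^ l, ?_, ?_, ?_, ?_⟩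
  · refine (MvPolynomial.totalDegree_mul _ _).trans ?_
    rw [MvPolynomial.totalDegree_C, zero_add]
    refine (MvPolynomial.totalDegree_pow _ _).trans ?_
    calc l * w.totalDegree ≤ l * (N * 2) := Nat.mul_le_mul_left _ hdeg
      _ = 2 * l * N := by ring
  · intro t ht
    rw [map_mul, map_pow, MvPolynomial.eval_C]
    exact mul_nonneg (inv_nonneg.2 hI.le) (pow_nonneg (hφB t ht).1 l)
  · simp_rw [map_mul, map_pow, MvPolynomial.eval_C]
    rw [integral_const_mul]
    exact inv_mul_cancel₀ hI.ne'
  · simp_rw [map_mul, map_pow, MvPolynomial.eval_C, mul_left_comm _ I⁻¹]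
    rw [integral_const_mul, inv_mul_le_iff₀ hI]
    refine hupper.trans ?_
    have h1 : a ^ (-β) = L ^ β * (N : ℝ) ^ (-β) := by
      rw [ha, Real.div_rpow hN'.le hL.le, Real.rpow_neg hL.le, div_inv_eq_mul, mul_comm]
    have h2 : (2 : ℝ) ^ l = (1 / 4) ^ l * 8 ^ l := by
      rw [← mul_pow]
      norm_num
    calc a ^ (-β) * 2 ^ l * ((1 / a) ^ d * J)
        = (1 / 4) ^ l * ((1 / a) ^ d * V) * (L ^ β * 8 ^ l * J / V * (N : ℝ) ^ (-β)) := by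
          rw [h1, h2]
          field_simp
      _ ≤ I * (L ^ β * 8 ^ l * J / V * (N : ℝ) ^ (-β)) := by gcongr

end JacksonKernel

section JacksonApproximation

open MeasureTheory

variable {d : ℕ}

theorem exists_eval_eq_setIntegral_dilate {f : EuclideanSpace ℝ (Fin d) → ℝ} (hf : Continuous f)
    {R R' L : ℝ} (hL : R + R' ≤ L) (W : MvPolynomial (Fin d) ℝ) {k : ℕ} (hk : 0 < k) :
    ∃ Q : MvPolynomial (Fin d) ℝ, Q.totalDegree ≤ W.totalDegree ∧
      ∀ x ∈ Metric.closedBall (0 : EuclideanSpace ℝ (Fin d)) R,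
        MvPolynomial.eval x.ofLp Q = ∫ t in Metric.closedBall (0 : EuclideanSpace ℝ (Fin d)) L,
          (Metric.closedBall 0 R').indicator f (x + k • t) * MvPolynomial.eval t.ofLp W := by
  have hk' : (0 : ℝ) < k := by exact_mod_cast hk
  have hk1 : (1 : ℝ) ≤ k := by exact_mod_cast hk
  let E := EuclideanSpace ℝ (Fin d)
  let B' := Metric.closedBall (0 : E) R'
  obtain ⟨Q, hdeg, hQ⟩ := MvPolynomial.exists_eval_eq_integral (volume.restrict B') f
    (fun y : E => y.ofLp)
    (fun Q => (hf.mul (continuous_eval_ofLp Q)).continuousOn.integrableOn_compact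
      (isCompact_closedBall _ _)) W ((k : ℝ)⁻¹)
  refine ⟨MvPolynomial.C (|((k : ℝ) ^ Module.finrank ℝ E)⁻¹|) * Q, ?_, fun x hx => ?_⟩
  · refine (MvPolynomial.totalDegree_mul _ _).trans ?_
    rwa [MvPolynomial.totalDegree_C, zero_add]
  have hx' : ‖x‖ ≤ R := mem_closedBall_zero_iff.1 hx
  rw [setIntegral_eq_integral_of_forall_compl_eq_zero]
  · let h : E → ℝ := fun z =>
      B'.indicator f (x + z) * MvPolynomial.eval ((k : ℝ)⁻¹ • z).ofLp W
    have h1 : (fun t : E => B'.indicator f (x + k • t) * MvPolynomial.eval t.ofLp W) =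
        fun t => h ((k : ℝ) • t) := by
      ext t
      simp only [h]
      rw [inv_smul_smul₀ hk'.ne', Nat.cast_smul_eq_nsmul]
    rw [h1, Measure.integral_comp_smul, smul_eq_mul, map_mul, MvPolynomial.eval_C, hQ,
      ← integral_sub_right_eq_self h x, ← integral_indicator measurableSet_closedBall]
    congr 2
    ext y
    simp only [h, add_sub_cancel]
    by_cases hy : y ∈ B'
    · rw [Set.indicator_of_mem hy, Set.indicator_of_mem hy]
      rfl
    · rw [Set.indicator_of_notMem hy, Set.indicator_of_notMem hy, zero_mul]
  · intro t ht
    rw [Set.indicator_of_notMem, zero_mul]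
    rw [mem_closedBall_zero_iff] at ht ⊢
    intro hcon
    apply ht
    have h1 : ‖(k : ℝ) • t‖ ≤ ‖x + k • t‖ + ‖x‖ := by
      rw [Nat.cast_smul_eq_nsmul]
      have := norm_sub_le (x + k • t) x
      rwa [add_sub_cancel_left] at this
    rw [norm_smul, Real.norm_eq_abs, abs_of_pos hk'] at h1
    have h2 : ‖t‖ ≤ k * ‖t‖ := le_mul_of_one_le_left (norm_nonneg _) hk1
    linarith

theorem exists_abs_fwdDiff_iter_indicator_le {n : ℕ} {α : NNReal}
    {f : EuclideanSpace ℝ (Fin d) → ℝ} (hf : IsCnHolder n α f) (R : ℝ) :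
    ∃ C : ℝ, 0 ≤ C ∧ ∀ x ∈ Metric.closedBall (0 : EuclideanSpace ℝ (Fin d)) R, ∀ t,
      |(fwdDiff t)^[n + 1] ((Metric.closedBall 0 (R + (n + 1))).indicator f) x| ≤
        C * ‖t‖ ^ (n + α : ℝ) := by
  obtain ⟨C, δ, hC, hδ, hδ1, h⟩ := exists_abs_fwdDiff_iter_le hf.1 hf.2 R
  set B' := Metric.closedBall (0 : EuclideanSpace ℝ (Fin d)) (R + (n + 1)) with hB'
  obtain ⟨M, hM⟩ := (isCompact_closedBall (0 : EuclideanSpace ℝ (Fin d))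
    (R + (n + 1))).exists_bound_of_continuousOn hf.1.continuous.continuousOn
  have hind (y) : |B'.indicator f y| ≤ max M 0 := by
    by_cases hy : y ∈ B'
    · rw [Set.indicator_of_mem hy]
      exact (Real.norm_eq_abs (f y) ▸ hM y hy).trans (le_max_left _ _)
    · rw [Set.indicator_of_notMem hy, abs_zero]
      exact le_max_right _ _
  let c : ℕ → ℤ := fun k => (-1) ^ (n + 1 - k) * (n + 1).choose k
  let S : ℝ := ∑ k ∈ Finset.range (n + 1 + 1), |(c k : ℝ)|
  have hS : 0 ≤ S := Finset.sum_nonneg fun k _ => abs_nonneg _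
  have hM0 : 0 ≤ max M 0 := le_max_right _ _
  refine ⟨max C (S * max M 0 * δ ^ (-(n + α : ℝ))), le_max_of_le_left hC, fun x hx t => ?_⟩
  rcases le_or_gt ‖t‖ δ with ht | ht
  · have heq : (fwdDiff t)^[n + 1] (B'.indicator f) x = (fwdDiff t)^[n + 1] f x := by
      rw [fwdDiff_iter_eq_sum_shift, fwdDiff_iter_eq_sum_shift]
      refine Finset.sum_congr rfl fun k hk => ?_
      rw [Set.indicator_of_mem]
      rw [hB', mem_closedBall_zero_iff]
      rw [mem_closedBall_zero_iff] at hx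
      refine (norm_add_le _ _).trans (add_le_add hx ?_)
      rw [← Nat.cast_smul_eq_nsmul ℝ, norm_smul, Real.norm_natCast]
      have hk' : (k : ℝ) ≤ n + 1 := by
        exact_mod_cast Nat.lt_succ_iff.1 (Finset.mem_range.1 hk)
      exact (mul_le_mul hk' (ht.trans hδ1) (norm_nonneg _) (by positivity)).trans_eq (mul_one _)
    rw [heq]
    refine (h x hx t ht).trans ?_
    gcongr
    exact le_max_left _ _
  · have h1 : |(fwdDiff t)^[n + 1] (B'.indicator f) x| ≤ S * max M 0 := by
      rw [fwdDiff_iter_eq_sum_shift, Finset.sum_mul]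
      refine (Finset.abs_sum_le_sum_abs _ _).trans (Finset.sum_le_sum fun k _ => ?_)
      rw [zsmul_eq_mul, abs_mul]
      exact mul_le_mul_of_nonneg_left (hind _) (abs_nonneg _)
    have h2 : 1 ≤ δ ^ (-(n + α : ℝ)) * ‖t‖ ^ (n + α : ℝ) := by
      rw [Real.rpow_neg hδ.le, inv_mul_eq_div, one_le_div (by positivity)]
      exact Real.rpow_le_rpow hδ.le ht.le (by positivity)
    calc _ ≤ S * max M 0 * (δ ^ (-(n + α : ℝ)) * ‖t‖ ^ (n + α : ℝ)) :=
          h1.trans (le_mul_of_one_le_right (by positivity) h2)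
      _ = S * max M 0 * δ ^ (-(n + α : ℝ)) * ‖t‖ ^ (n + α : ℝ) := by ring
      _ ≤ _ := by
        gcongr
        exact le_max_right _ _

theorem IsCnHolder.exists_mvPolynomial_approx {n : ℕ} {α : NNReal} (hα : 0 < α)
    {f : EuclideanSpace ℝ (Fin d) → ℝ} (hf : IsCnHolder n α f) {R : ℝ} (hR : 0 < R) :
    ∃ (C : ℝ) (D : ℕ), 0 ≤ C ∧ ∀ N : ℕ, 0 < N → ∃ p : MvPolynomial (Fin d) ℝ,
      p.totalDegree ≤ D * N ∧ ∀ x ∈ Metric.closedBall (0 : EuclideanSpace ℝ (Fin d)) R,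
        |f x - MvPolynomial.eval x.ofLp p| ≤ C * (N : ℝ) ^ (-(n + α : ℝ)) := by
  have hβ : (0 : ℝ) < n + α := by positivity
  obtain ⟨C₁, hC₁, hΔ⟩ := exists_abs_fwdDiff_iter_indicator_le hf R
  have hL : 0 < R + (R + (n + 1)) := by positivity
  obtain ⟨C₂, D, hC₂, hker⟩ := exists_jackson_kernel d hβ hL
  refine ⟨C₁ * C₂, D, by positivity, fun N hN => ?_⟩
  obtain ⟨W, hdeg, hpos, hone, hmom⟩ := hker N hN
  have hcont : Continuous f := hf.1.continuous
  choose Q hQdeg hQ using fun k : ℕ => exists_eval_eq_setIntegral_dilate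
    (R := R) (R' := R + (n + 1)) hcont le_rfl W k.succ_pos
  let c : ℕ → ℤ := fun k => (-1) ^ (n + 1 - k) * (n + 1).choose k
  have hc0 : (c 0 : ℝ) = (-1) ^ (n + 1) := by simp [c]
  refine ⟨MvPolynomial.C (-(-1) ^ (n + 1)) * ∑ k ∈ Finset.range (n + 1),
    MvPolynomial.C (c (k + 1) : ℝ) * Q k, ?_, fun x hx => ?_⟩
  · refine (MvPolynomial.totalDegree_mul _ _).trans ?_
    rw [MvPolynomial.totalDegree_C, zero_add]
    refine MvPolynomial.totalDegree_finsetSum_le fun k _ => ?_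
    refine (MvPolynomial.totalDegree_mul _ _).trans ?_
    rw [MvPolynomial.totalDegree_C, zero_add]
    exact (hQdeg k).trans hdeg
  set B := Metric.closedBall (0 : EuclideanSpace ℝ (Fin d)) (R + (R + (n + 1))) with hB
  set g := (Metric.closedBall (0 : EuclideanSpace ℝ (Fin d)) (R + (n + 1))).indicator f with hg
  have hgx : g x = f x := Set.indicator_of_mem
    (Metric.closedBall_subset_closedBall (by linarith) hx) f
  let w : EuclideanSpace ℝ (Fin d) → ℝ := fun t => MvPolynomial.eval t.ofLp W
  have hw : Continuous w := continuous_eval_ofLp W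
  have hinteg (k : ℕ) : IntegrableOn (fun t => g (x + k • t) * w t) B := by
    have h1 : Continuous fun t : EuclideanSpace ℝ (Fin d) => x + k • t := by fun_prop
    have h2 : IntegrableOn (fun t => f (x + k • t) * w t) B :=
      ((hcont.comp h1).mul hw).continuousOn.integrableOn_compact (isCompact_closedBall _ _)
    have h3 := h2.indicator (h1.measurable (measurableSet_closedBall (x := 0)
      (ε := R + (n + 1 : ℝ))))
    refine h3.congr (Filter.Eventually.of_forall fun t => ?_)
    by_cases ht : x + k • t ∈ Metric.closedBall (0 : EuclideanSpace ℝ (Fin d)) (R + (n + 1))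
    · simp only [hg]
      rw [Set.indicator_of_mem (by exact ht), Set.indicator_of_mem ht]
    · simp only [hg]
      rw [Set.indicator_of_notMem (by exact ht), Set.indicator_of_notMem ht, zero_mul]
  have hsum : ∫ t in B, (fwdDiff t)^[n + 1] g x * w t =
      ∑ k ∈ Finset.range (n + 1 + 1), (c k : ℝ) * ∫ t in B, g (x + k • t) * w t := by
    simp_rw [← integral_const_mul]
    rw [← integral_finsetSum _ fun k _ => (hinteg k).const_mul _]
    refine integral_congr_ae (Filter.Eventually.of_forall fun t => ?_)
    simp only [fwdDiff_iter_eq_sum_shift, Finset.sum_mul, zsmul_eq_mul, mul_assoc, c]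
  have hzero : ∫ t in B, g (x + 0 • t) * w t = f x := by
    simp_rw [zero_smul, add_zero, hgx]
    rw [integral_const_mul, hone, mul_one]
  have hdiff : f x - MvPolynomial.eval x.ofLp (MvPolynomial.C (-(-1) ^ (n + 1)) *
      ∑ k ∈ Finset.range (n + 1), MvPolynomial.C (c (k + 1) : ℝ) * Q k) =
      (-1) ^ (n + 1) * ∫ t in B, (fwdDiff t)^[n + 1] g x * w t := by
    rw [hsum, Finset.sum_range_succ' _ (n + 1), hzero, hc0, mul_add, ← mul_assoc ((-1) ^ (n + 1)),
      ← mul_pow]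
    simp only [map_mul, map_sum, MvPolynomial.eval_C, hQ _ x hx, hg, w, hB, Nat.succ_eq_add_one]
    norm_num
    ring
  rw [hdiff, abs_mul, abs_pow, abs_neg, abs_one, one_pow, one_mul]
  have hmint : IntegrableOn (fun t => ‖t‖ ^ (n + α : ℝ) * w t) B :=
    ((continuous_norm.rpow_const fun _ => Or.inr hβ.le).mul
      hw).continuousOn.integrableOn_compact (isCompact_closedBall _ _)
  calc |∫ t in B, (fwdDiff t)^[n + 1] g x * w t|
      ≤ ∫ t in B, C₁ * (‖t‖ ^ (n + α : ℝ) * w t) := by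
        rw [← Real.norm_eq_abs]
        refine norm_integral_le_of_norm_le (hmint.const_mul _) ?_
        filter_upwards [ae_restrict_mem measurableSet_closedBall] with t ht
        rw [Real.norm_eq_abs, abs_mul, abs_of_nonneg (hpos t ht), ← mul_assoc]
        exact mul_le_mul_of_nonneg_right (hΔ x hx t) (hpos t ht)
    _ = C₁ * ∫ t in B, ‖t‖ ^ (n + α : ℝ) * w t := integral_const_mul _ _
    _ ≤ C₁ * (C₂ * (N : ℝ) ^ (-(n + α : ℝ))) := by gcongr
    _ = C₁ * C₂ * (N : ℝ) ^ (-(n + α : ℝ)) := by ring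

end JacksonApproximation

section SymmetricLift

namespace MvPolynomial

theorem IsHomogeneous.eval_smul {σ R : Type*} [CommSemiring R] {P : MvPolynomial σ R} {m : ℕ}
    (hP : P.IsHomogeneous m) (s : R) (x : σ → R) : eval (s • x) P = s ^ m * eval x P := by
  rw [eval_eq, eval_eq, Finset.mul_sum]
  refine Finset.sum_congr rfl fun e he => ?_
  have hm : ∑ i ∈ e.support, e i = m := by
    have := hP (mem_support_iff.1 he)
    rwa [Finsupp.weight_apply, Finsupp.sum, Finset.sum_congr rfl fun i _ => by
      rw [Pi.one_apply, smul_eq_mul, mul_one]] at this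
  simp_rw [Pi.smul_apply, smul_eq_mul, mul_pow]
  rw [Finset.prod_mul_distrib, Finset.prod_pow_eq_pow_sum, hm]
  ring

theorem eval_smul_eq_sum {σ R : Type*} [CommSemiring R] (P : MvPolynomial σ R) {M : ℕ}
    (hM : P.totalDegree ≤ M) (s : R) (x : σ → R) :
    eval (s • x) P = (∑ j ∈ Finset.range (M + 1),
      Polynomial.C (eval x (homogeneousComponent j P)) * Polynomial.X ^ j).eval s := by
  have h : P = ∑ j ∈ Finset.range (M + 1), homogeneousComponent j P := by
    conv_lhs => rw [← sum_homogeneousComponent P]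
    refine Finset.sum_subset (Finset.range_subset_range.2 (by omega)) fun j _ hj => ?_
    exact homogeneousComponent_eq_zero _ _ (by simpa [Nat.lt_succ_iff] using hj)
  conv_lhs => rw [h]
  rw [map_sum, Polynomial.eval_finsetSum]
  refine Finset.sum_congr rfl fun j _ => ?_
  rw [(homogeneousComponent_isHomogeneous j P).eval_smul]
  rw [Polynomial.eval_mul, Polynomial.eval_C, Polynomial.eval_pow, Polynomial.eval_X, mul_comm]

theorem exists_totalDegree_le_of_eval_smul_eq {σ τ : Type*} (P : MvPolynomial σ ℝ)
    (p : MvPolynomial τ ℝ) (S : Set ((σ → ℝ) × (τ → ℝ)))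
    (hS : ∀ z ∈ S, ∀ s : ℝ, eval (s • z.1) P = eval (s • z.2) p) :
    ∃ Q : MvPolynomial σ ℝ, Q.totalDegree ≤ p.totalDegree ∧
      ∀ z ∈ S, eval z.1 Q = eval z.2 p := by
  refine ⟨∑ j ∈ Finset.range (p.totalDegree + 1), homogeneousComponent j P, ?_, ?_⟩
  · refine totalDegree_finsetSum_le fun j hj => ?_
    exact (homogeneousComponent_isHomogeneous j P).totalDegree_le.trans
      (Nat.lt_succ_iff.1 (Finset.mem_range.1 hj))
  · intro z hz
    let M := max P.totalDegree p.totalDegree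
    have hpoly : (∑ j ∈ Finset.range (M + 1),
        Polynomial.C (eval z.1 (homogeneousComponent j P)) * Polynomial.X ^ j) =
        ∑ j ∈ Finset.range (M + 1),
          Polynomial.C (eval z.2 (homogeneousComponent j p)) * Polynomial.X ^ j :=
      Polynomial.funext fun s => by
        rw [← eval_smul_eq_sum P (le_max_left _ _), ← eval_smul_eq_sum p (le_max_right _ _),
          hS z hz]
    conv_rhs => rw [← sum_homogeneousComponent p]
    rw [map_sum, map_sum]
    refine Finset.sum_congr rfl fun j hj => ?_
    have hjM : j < M + 1 :=
      (Finset.mem_range.1 hj).trans_le (Nat.succ_le_succ (le_max_right _ _))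
    have := congrArg (fun q => Polynomial.coeff q j) hpoly
    simpa [Polynomial.finsetSum_coeff, Polynomial.coeff_C_mul, Polynomial.coeff_X_pow, hjM,
      Finset.sum_ite_eq] using this

theorem IsSymmetric.exists_eval_entries_eq {d : ℕ} {p : MvPolynomial (Fin d) ℝ}
    (hp : p.IsSymmetric) :
    ∃ P : MvPolynomial (Fin d × Fin d) ℝ, P.totalDegree ≤ p.totalDegree ∧
      ∀ g : Matrix (Fin d) (Fin d) ℝ, g * gᵀ = 1 → ∀ v : Fin d → ℝ,
        eval (fun ij => (g * Matrix.diagonal v * gᵀ) ij.1 ij.2) P = eval v p := by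
  obtain ⟨q, hq⟩ := esymmAlgHom_surjective (σ := Fin d) (R := ℝ) (n := d) (by simp) ⟨p, hp⟩
  have hq' : aeval (fun i : Fin d => esymm (Fin d) ℝ (i + 1)) q = p := by
    rw [← esymmAlgHom_apply, hq]
  let e : Fin d → MvPolynomial (Fin d × Fin d) ℝ := fun i =>
    MvPolynomial.C ((-1) ^ (i + 1 : ℕ)) * (Matrix.charpoly.univ ℝ (Fin d)).coeff (d - (i + 1))
  have he (g : Matrix (Fin d) (Fin d) ℝ) (hg : g * gᵀ = 1) (v : Fin d → ℝ) (i : Fin d) :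
      eval (fun ij => (g * Matrix.diagonal v * gᵀ) ij.1 ij.2) (e i) =
        eval v (esymm (Fin d) ℝ (i + 1)) := by
    have hchar : (g * Matrix.diagonal v * gᵀ).charpoly =
        ((Finset.univ.val.map v).map fun t => Polynomial.X - Polynomial.C t).prod := by
      rw [Matrix.charpoly_mul_comm, ← mul_assoc, mul_eq_one_comm.1 hg, one_mul,
        Matrix.charpoly_diagonal, Multiset.map_map]
      rfl
    have hcoeff : eval (fun ij => (g * Matrix.diagonal v * gᵀ) ij.1 ij.2)
        ((Matrix.charpoly.univ ℝ (Fin d)).coeff (d - (i + 1))) =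
        (g * Matrix.diagonal v * gᵀ).charpoly.coeff (d - (i + 1)) :=
      Matrix.charpoly.univ_coeff_eval₂Hom (Fin d) (RingHom.id ℝ) _ _
    have hsub : d - (d - (i + 1 : ℕ)) = i + 1 := by omega
    have haev := aeval_esymm_eq_multiset_esymm (Fin d) ℝ (i + 1) v
    rw [map_mul, eval_C, hcoeff, hchar, Multiset.prod_X_sub_C_coeff _ (by simp),
      Multiset.card_map, Finset.card_val, Finset.card_univ, Fintype.card_fin, hsub, ← haev,
      ← mul_assoc, ← mul_pow]
    simp [aeval_eq_eval]
  refine (exists_totalDegree_le_of_eval_smul_eq (aeval e q) p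
    {z | ∃ g : Matrix (Fin d) (Fin d) ℝ, g * gᵀ = 1 ∧
      z.1 = fun ij => (g * Matrix.diagonal z.2 * gᵀ) ij.1 ij.2} ?_).imp fun P hP =>
    ⟨hP.1, fun g hg v => hP.2 (_, v) ⟨g, hg, rfl⟩⟩
  rintro ⟨x, v⟩ ⟨g, hg, hx⟩ s
  obtain rfl : x = fun ij => (g * Matrix.diagonal v * gᵀ) ij.1 ij.2 := hx
  have hsm : (s • fun ij : Fin d × Fin d => (g * Matrix.diagonal v * gᵀ) ij.1 ij.2) =
      fun ij => (g * Matrix.diagonal (s • v) * gᵀ) ij.1 ij.2 := by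
    ext ij
    rw [Matrix.diagonal_smul, Matrix.mul_smul, Matrix.smul_mul]
    rfl
  rw [← hq', hsm]
  change eval _ (aeval e q) = eval (s • v) _
  rw [aeval_def, aeval_def, hom_eval₂, hom_eval₂]
  congr 1
  · ext; simp [algebraMap_eq]
  · funext i
    exact he g hg (s • v) i

theorem exists_isSymmetric_approx {d : ℕ} {f : EuclideanSpace ℝ (Fin d) → ℝ}
    (hf : ∀ (e : Equiv.Perm (Fin d)) (x : EuclideanSpace ℝ (Fin d)),
      f (WithLp.toLp 2 (x.ofLp ∘ e)) = f x) (p : MvPolynomial (Fin d) ℝ) {R ε : ℝ}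
    (hp : ∀ x ∈ Metric.closedBall (0 : EuclideanSpace ℝ (Fin d)) R,
      |f x - eval x.ofLp p| ≤ ε) :
    ∃ q : MvPolynomial (Fin d) ℝ, q.IsSymmetric ∧ q.totalDegree ≤ p.totalDegree ∧
      ∀ x ∈ Metric.closedBall (0 : EuclideanSpace ℝ (Fin d)) R, |f x - eval x.ofLp q| ≤ ε := by
  let K : ℝ := Fintype.card (Equiv.Perm (Fin d))
  have hK : 0 < K := Nat.cast_pos.2 Fintype.card_pos
  refine ⟨C K⁻¹ * ∑ e : Equiv.Perm (Fin d), rename e p, ?_, ?_, fun x hx => ?_⟩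
  · intro τ
    rw [map_mul, map_sum, algHom_C, algebraMap_eq]
    congr 1
    simp_rw [rename_rename]
    exact Fintype.sum_equiv (Equiv.mulLeft τ) _ _ fun e => rfl
  · refine (totalDegree_mul _ _).trans ?_
    rw [totalDegree_C, zero_add]
    exact totalDegree_finsetSum_le fun e _ => totalDegree_rename_le _ _
  · have hterm (e : Equiv.Perm (Fin d)) : |f x - eval x.ofLp (rename e p)| ≤ ε := by
      have hmem : WithLp.toLp 2 (x.ofLp ∘ e) ∈
          Metric.closedBall (0 : EuclideanSpace ℝ (Fin d)) R := by
        rw [mem_closedBall_zero_iff] at hx ⊢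
        convert hx using 1
        rw [EuclideanSpace.norm_eq, EuclideanSpace.norm_eq]
        congr 1
        exact Equiv.sum_comp e fun i => ‖x.ofLp i‖ ^ 2
      have := hp _ hmem
      rwa [hf, ← eval_rename] at this
    have hsum : f x - eval x.ofLp (C K⁻¹ * ∑ e : Equiv.Perm (Fin d), rename e p) =
        K⁻¹ * ∑ e : Equiv.Perm (Fin d), (f x - eval x.ofLp (rename e p)) := by
      rw [Finset.sum_sub_distrib, Finset.sum_const, Finset.card_univ, nsmul_eq_mul, mul_sub,
        inv_mul_cancel_left₀ hK.ne', map_mul, eval_C, map_sum]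
    rw [hsum, abs_mul, abs_of_pos (inv_pos.2 hK), inv_mul_le_iff₀ hK]
    refine (Finset.abs_sum_le_sum_abs _ _).trans ((Finset.sum_le_sum fun e _ => hterm e).trans ?_)
    rw [Finset.sum_const, Finset.card_univ, nsmul_eq_mul]

end MvPolynomial

end SymmetricLift

section SymmetricMatrices

namespace Matrix

theorem frobenius_norm_sq_eq_trace {m n : Type*} [Fintype m] [Fintype n] (A : Matrix m n ℝ) :
    ‖A‖ ^ 2 = (A * Aᵀ).trace := by
  rw [frobenius_norm_def, ← Real.sqrt_eq_rpow, Real.sq_sqrt (by positivity)]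
  simp [trace, mul_apply, ← sq]

theorem frobenius_norm_orthogonal_conj {n : Type*} [Fintype n] [DecidableEq n]
    {g : Matrix n n ℝ} (hg : g * gᵀ = 1) (A : Matrix n n ℝ) : ‖g * A * gᵀ‖ = ‖A‖ := by
  refine (sq_eq_sq₀ (norm_nonneg _) (norm_nonneg _)).1 ?_
  have h : g * A * gᵀ * (g * A * gᵀ)ᵀ = g * (A * Aᵀ * gᵀ) := by
    simp only [transpose_mul, transpose_transpose, mul_assoc]
    rw [← mul_assoc gᵀ g, mul_eq_one_comm.1 hg, one_mul]
  rw [frobenius_norm_sq_eq_trace, frobenius_norm_sq_eq_trace, h, trace_mul_comm, mul_assoc,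
    mul_eq_one_comm.1 hg, mul_one]

end Matrix

namespace SymMat

variable {d : ℕ}

theorem exists_eq_conj_diagonal (X : SymMat d) :
    ∃ g : Matrix (Fin d) (Fin d) ℝ, g * gᵀ = 1 ∧ ∃ v : EuclideanSpace ℝ (Fin d),
      ‖v‖ = ‖X‖ ∧ (X : Matrix (Fin d) (Fin d) ℝ) = g * Matrix.diagonal v.ofLp * gᵀ := by
  have hX : (X : Matrix (Fin d) (Fin d) ℝ).IsHermitian := by
    rw [Matrix.IsHermitian, Matrix.conjTranspose_eq_transpose_of_trivial]
    exact X.2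
  let g : Matrix (Fin d) (Fin d) ℝ := hX.eigenvectorUnitary
  have hg : g * gᵀ = 1 := by
    rw [← Matrix.conjTranspose_eq_transpose_of_trivial, ← Matrix.star_eq_conjTranspose]
    exact Unitary.mul_star_self_of_mem hX.eigenvectorUnitary.2
  have hspec : (X : Matrix (Fin d) (Fin d) ℝ) = g * Matrix.diagonal hX.eigenvalues * gᵀ := by
    conv_lhs => rw [hX.spectral_theorem, Unitary.conjStarAlgAut_apply]
    rw [← Matrix.conjTranspose_eq_transpose_of_trivial, ← Matrix.star_eq_conjTranspose]
    rfl
  refine ⟨g, hg, WithLp.toLp 2 hX.eigenvalues, ?_, hspec⟩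
  rw [← Matrix.frobenius_norm_diagonal, ← Matrix.frobenius_norm_orthogonal_conj hg, ← hspec]
  rfl

/-- The matrix entries as continuous linear functionals. -/
noncomputable def entry (ij : Fin d × Fin d) : SymMat d →L[ℝ] ℝ :=
  LinearMap.toContinuousLinearMap
    ((Matrix.entryLinearMap ℝ ℝ ij.1 ij.2).comp (SymMat d).subtype)

theorem apply_diagonal_comp_perm {F : SymMat d → ℝ}
    (hinv : ∀ g : Matrix (Fin d) (Fin d) ℝ, g * gᵀ = 1 → ∀ x y : SymMat d,
      (y : Matrix (Fin d) (Fin d) ℝ) = g * (x : Matrix (Fin d) (Fin d) ℝ) * gᵀ → F y = F x)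
    (e : Equiv.Perm (Fin d)) (v : Fin d → ℝ) :
    F ⟨Matrix.diagonal (v ∘ e), Matrix.isSymm_diagonal _⟩ =
      F ⟨Matrix.diagonal v, Matrix.isSymm_diagonal _⟩ := by
  refine hinv ((1 : Matrix (Fin d) (Fin d) ℝ).submatrix e id) ?_ _ _ ?_
  · ext i j
    simp [Matrix.mul_apply, Matrix.one_apply]
  · ext i j
    by_cases hij : i = j <;>
      simp [Matrix.mul_apply, Matrix.one_apply, Matrix.diagonal_apply, hij]

theorem exists_polyMap_approx {F : SymMat d → ℝ}
    (hinv : ∀ g : Matrix (Fin d) (Fin d) ℝ, g * gᵀ = 1 → ∀ x y : SymMat d,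
      (y : Matrix (Fin d) (Fin d) ℝ) = g * (x : Matrix (Fin d) (Fin d) ℝ) * gᵀ → F y = F x)
    {p : MvPolynomial (Fin d) ℝ} {R ε : ℝ}
    (hp : ∀ x ∈ Metric.closedBall (0 : EuclideanSpace ℝ (Fin d)) R,
      |F ⟨Matrix.diagonal x.ofLp, Matrix.isSymm_diagonal _⟩ - MvPolynomial.eval x.ofLp p| ≤ ε) :
    ∃ P : MvPolynomial (Fin d × Fin d) ℝ, P.totalDegree ≤ p.totalDegree ∧
      ∀ X ∈ Metric.closedBall (0 : SymMat d) R, |F X - polyMap entry P X| ≤ ε := by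
  obtain ⟨q, hqs, hqd, hq⟩ := MvPolynomial.exists_isSymmetric_approx
    (f := fun x => F ⟨Matrix.diagonal x.ofLp, Matrix.isSymm_diagonal _⟩)
    (fun e x => apply_diagonal_comp_perm hinv e x.ofLp) p hp
  obtain ⟨P, hPd, hP⟩ := hqs.exists_eval_entries_eq
  refine ⟨P, hPd.trans hqd, fun X hX => ?_⟩
  obtain ⟨g, hg, v, hv, hXv⟩ := exists_eq_conj_diagonal X
  rw [mem_closedBall_zero_iff, ← hv, ← mem_closedBall_zero_iff] at hX
  have hpoly : polyMap entry P X = MvPolynomial.eval v.ofLp q := by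
    rw [← hP g hg, ← hXv]
    rfl
  rw [hinv g hg ⟨Matrix.diagonal v.ofLp, Matrix.isSymm_diagonal _⟩ X hXv, hpoly]
  exact hq v hX

end SymMat

end SymmetricMatrices

section InverseTheorem

open Filter Topology

theorem polyMap_sub {E ι : Type*} [NormedAddCommGroup E] [NormedSpace ℝ E]
    (ℓ : ι → E →L[ℝ] ℝ) (P Q : MvPolynomial ι ℝ) :
    polyMap ℓ (P - Q) = polyMap ℓ P - polyMap ℓ Q := by
  funext x
  exact map_sub _ P Q

/-- **Inverse theorem of Bernstein**: a function which is approximated by polynomials of degree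
`O(N)` up to an error `O(N ^ (-(n + α)))` is of class `C^{n,α}`. -/
theorem isCnHolder_of_polyMap_approx {E ι : Type*} [NormedAddCommGroup E] [NormedSpace ℝ E]
    [ProperSpace E] [Fintype ι] (ℓ : ι → E →L[ℝ] ℝ) {n : ℕ} {α : NNReal} (hα0 : 0 < α)
    (hα1 : α < 1) {F : E → ℝ}
    (hF : ∀ R : ℝ, 0 < R → ∃ (C : ℝ) (D : ℕ), 0 ≤ C ∧ ∀ N : ℕ, 0 < N →
      ∃ P : MvPolynomial ι ℝ, P.totalDegree ≤ D * N ∧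
        ∀ x ∈ Metric.closedBall (0 : E) R, |F x - polyMap ℓ P x| ≤ C * (N : ℝ) ^ (-(n + α : ℝ))) :
    IsCnHolder n α F := by
  suffices h : ∀ x₀ : E, ContDiffOn ℝ n F (Metric.ball x₀ (1 / 2)) ∧
      ∃ K : NNReal, HolderOnWith K α (iteratedFDeriv ℝ n F) (Metric.ball x₀ (1 / 2)) by
    refine ⟨contDiff_iff_contDiffAt.2 fun x => ?_, fun x => ?_⟩
    · exact (h x).1.contDiffAt (Metric.ball_mem_nhds x (by norm_num))
    · obtain ⟨K, hK⟩ := (h x).2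
      exact ⟨K, _, Metric.ball_mem_nhds x (by norm_num), hK⟩
  intro x₀
  have hα : (0 : ℝ) < α := by exact_mod_cast hα0
  set R : ℝ := ‖x₀‖ + (n + 2) with hRdef
  have hR : 0 < R := by positivity
  obtain ⟨C, D, hC, hN⟩ := hF R hR
  choose! P hPdeg hP using hN
  obtain ⟨B, hB⟩ := (isCompact_closedBall (0 : E) R).exists_bound_of_continuousOn
    (contDiff_polyMap (m := 0) ℓ (P 1)).continuous.continuousOn
  have hB0 : 0 ≤ B := (norm_nonneg _).trans (hB 0 (Metric.mem_closedBall_self hR.le))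
  set A : ℝ := B + C with hA
  have hA0 : 0 ≤ A := by positivity
  obtain ⟨a, ha⟩ : ∃ a : ℝ, a = (1 / 2 : ℝ) ^ (α : ℝ) := ⟨_, rfl⟩
  have ha0 : 0 < a := by rw [ha]; positivity
  have ha1 : a < 1 := by
    rw [ha]; exact Real.rpow_lt_one (by norm_num) (by norm_num) hα
  have hpow (j : ℕ) : (((2 ^ j : ℕ) : ℝ)) ^ (-(n + α : ℝ)) = ((1 / 2 : ℝ) ^ j) ^ n * a ^ j := by
    have h2 : ((2 ^ j : ℕ) : ℝ) = ((1 / 2 : ℝ) ^ j)⁻¹ := by simp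
    rw [h2, Real.inv_rpow (by positivity), Real.rpow_neg (by positivity), inv_inv,
      Real.rpow_add (by positivity), Real.rpow_natCast, ha, Real.rpow_pow_comm (by norm_num)]
  let Q : ℕ → MvPolynomial ι ℝ := fun j => if j = 0 then 0 else P (2 ^ j)
  have hQ0 : polyMap ℓ (Q 0) = 0 := by
    funext x
    simp [Q, polyMap]
  have hQdeg (j : ℕ) : (Q j).totalDegree ≤ D * 2 ^ j := by
    by_cases hj : j = 0
    · simp [Q, hj]
    · simpa only [Q, if_neg hj] using hPdeg (2 ^ j) (by positivity)
  have hQ (j : ℕ) (x : E) (hx : x ∈ Metric.closedBall (0 : E) R) :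
      |F x - polyMap ℓ (Q j) x| ≤ A * (((1 / 2 : ℝ) ^ j) ^ n * a ^ j) := by
    by_cases hj : j = 0
    · have h1 := hP 1 one_pos x hx
      have h2 := hB x hx
      rw [Nat.cast_one, Real.one_rpow, mul_one] at h1
      rw [Real.norm_eq_abs] at h2
      rw [hj, hQ0, Pi.zero_apply, sub_zero, pow_zero, one_pow, pow_zero, mul_one, mul_one]
      have := abs_add_le (F x - polyMap ℓ (P 1) x) (polyMap ℓ (P 1) x)
      rw [sub_add_cancel] at this
      linarith
    · have h1 := hP (2 ^ j) (by positivity) x hx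
      rw [hpow] at h1
      simp only [Q, if_neg hj]
      refine h1.trans ?_
      gcongr
      linarith
  have hW (j : ℕ) (x : E) (hx : x ∈ Metric.closedBall (0 : E) R) :
      |polyMap ℓ (Q (j + 1) - Q j) x| ≤ 2 * A * (((1 / 2 : ℝ) ^ j) ^ n * a ^ j) := by
    have h1 := hQ j x hx
    have h2 := hQ (j + 1) x hx
    have h3 : A * (((1 / 2 : ℝ) ^ (j + 1)) ^ n * a ^ (j + 1)) ≤
        A * (((1 / 2 : ℝ) ^ j) ^ n * a ^ j) := by
      gcongr A * (?_ ^ n * ?_)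
      · exact pow_le_pow_of_le_one (by norm_num) (by norm_num) j.le_succ
      · exact pow_le_pow_of_le_one ha0.le ha1.le j.le_succ
    rw [polyMap_sub, Pi.sub_apply]
    have := abs_sub (F x - polyMap ℓ (Q j) x) (F x - polyMap ℓ (Q (j + 1)) x)
    rw [sub_sub_sub_cancel_left] at this
    linarith
  let c : ℝ := Real.exp 1 * (2 * D + 1 : ℕ)
  have hc : 1 ≤ c := by
    have h1 : (1 : ℝ) ≤ Real.exp 1 := Real.one_le_exp zero_le_one
    have h2 : (1 : ℝ) ≤ (2 * D + 1 : ℕ) := by exact_mod_cast Nat.le_add_left 1 (2 * D)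
    exact one_le_mul_of_one_le_of_one_le h1 h2
  have hderiv (k : ℕ) (hk : k ≤ n + 1) (j : ℕ) (x : E) (hx : x ∈ Metric.ball x₀ (1 / 2)) :
      ‖iteratedFDeriv ℝ k (polyMap ℓ (Q (j + 1))) x - iteratedFDeriv ℝ k (polyMap ℓ (Q j)) x‖ ≤
        c ^ (n + 1) * (2 * A) * (((2 : ℝ) ^ j) ^ k * ((1 / 2 : ℝ) ^ j) ^ n * a ^ j) := by
    have hdeg : (Q (j + 1) - Q j).totalDegree ≤ (2 * D + 1) * 2 ^ j := by
      refine (MvPolynomial.totalDegree_sub _ _).trans (max_le ?_ ?_)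
      · refine (hQdeg (j + 1)).trans ?_
        rw [pow_succ]
        nlinarith [Nat.zero_le (2 ^ j)]
      · refine (hQdeg j).trans (Nat.mul_le_mul_right _ (by omega))
    have hball : ∀ z ∈ Metric.closedBall x₀ (1 / 2 + k * 1),
        |polyMap ℓ (Q (j + 1) - Q j) z| ≤ 2 * A * (((1 / 2 : ℝ) ^ j) ^ n * a ^ j) := by
      intro z hz
      refine hW j z (Metric.closedBall_subset_closedBall' ?_ hz)
      have : (k : ℝ) ≤ n + 1 := by exact_mod_cast hk
      rw [dist_zero_right]
      linarith
    have hbound := norm_iteratedFDeriv_polyMap_le ℓ (by positivity) hdeg one_pos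
      (by positivity) k hball (Metric.ball_subset_closedBall hx)
    have hsub : iteratedFDeriv ℝ k (polyMap ℓ (Q (j + 1) - Q j)) x =
        iteratedFDeriv ℝ k (polyMap ℓ (Q (j + 1))) x - iteratedFDeriv ℝ k (polyMap ℓ (Q j)) x := by
      rw [polyMap_sub]
      exact iteratedFDeriv_sub_apply (contDiff_polyMap ℓ _).contDiffAt
        (contDiff_polyMap ℓ _).contDiffAt
    rw [hsub] at hbound
    refine hbound.trans ?_
    have hck : c ^ k ≤ c ^ (n + 1) := pow_le_pow_right₀ hc hk
    calc (Real.exp 1 * ((2 * D + 1) * 2 ^ j : ℕ) / 1) ^ k *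
          (2 * A * (((1 / 2 : ℝ) ^ j) ^ n * a ^ j))
        = c ^ k * (2 * A) * (((2 : ℝ) ^ j) ^ k * ((1 / 2 : ℝ) ^ j) ^ n * a ^ j) := by
          have hcj : Real.exp 1 * ((2 * D + 1) * 2 ^ j : ℕ) / 1 = c * 2 ^ j := by
            rw [div_one, Nat.cast_mul, Nat.cast_pow, Nat.cast_ofNat, ← mul_assoc]
          rw [hcj, mul_pow]
          ring
      _ ≤ _ := by gcongr
  have htwo (j : ℕ) : (2 : ℝ) ^ j * (1 / 2) ^ j = 1 := by rw [← mul_pow]; norm_num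
  refine contDiffOn_and_holderOnWith_of_dyadic (G := fun j => polyMap ℓ (Q j)) hα0 hα1
    Metric.isOpen_ball (convex_ball x₀ _) (fun x hx y hy => ?_) (C := c ^ (n + 1) * (2 * A))
    (by positivity) ha (fun j => contDiff_polyMap ℓ _) hQ0 (fun k hk j x hx => ?_)
    (fun j x hx => ?_) (fun x hx => ?_)
  · rw [← dist_eq_norm]
    have := dist_triangle_right y x x₀
    rw [Metric.mem_ball] at hx hy
    linarith
  · refine (hderiv k (hk.trans n.le_succ) j x hx).trans ?_
    refine mul_le_mul_of_nonneg_left (mul_le_of_le_one_left (by positivity) ?_) (by positivity)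
    calc ((2 : ℝ) ^ j) ^ k * ((1 / 2 : ℝ) ^ j) ^ n
        ≤ ((2 : ℝ) ^ j) ^ n * ((1 / 2 : ℝ) ^ j) ^ n := by
          gcongr
          exact one_le_pow₀ one_le_two
      _ = 1 := by rw [← mul_pow, htwo, one_pow]
  · refine (hderiv (n + 1) le_rfl j x hx).trans_eq ?_
    rw [pow_succ ((2 : ℝ) ^ j), mul_right_comm _ _ (((1 / 2 : ℝ) ^ j) ^ n), ← mul_pow, htwo,
      one_pow, one_mul, ← mul_pow]
  · have hxR : x ∈ Metric.closedBall (0 : E) R := by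
      refine Metric.closedBall_subset_closedBall' ?_ (Metric.ball_subset_closedBall hx)
      rw [dist_zero_right]
      have : (0 : ℝ) ≤ n := n.cast_nonneg
      linarith
    rw [tendsto_iff_dist_tendsto_zero]
    refine squeeze_zero (fun _ => dist_nonneg) (g := fun j => A * a ^ j) (fun j => ?_) ?_
    · rw [dist_comm, Real.dist_eq]
      refine (hQ j x hxR).trans (mul_le_mul_of_nonneg_left
        (mul_le_of_le_one_left (by positivity) ?_) hA0)
      exact pow_le_one₀ (by positivity) (pow_le_one₀ (by norm_num) (by norm_num))
    · simpa using (tendsto_pow_atTop_nhds_zero_of_lt_one ha0.le ha1).const_mul A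

end InverseTheorem

/-- A rotation-invariant function on the real symmetric matrices whose restriction to the
diagonal matrices is `C^{n,α}` is itself `C^{n,α}`. -/
theorem rotation_invariant_holder_of_diagonal_restriction
    (d n : ℕ) (α : NNReal) (hα0 : 0 < α) (hα1 : α < 1) (F : SymMat d → ℝ)
    (hinv : ∀ g : Matrix (Fin d) (Fin d) ℝ, g * gᵀ = 1 →
      ∀ x y : SymMat d, (y : Matrix (Fin d) (Fin d) ℝ) = g * (x : Matrix (Fin d) (Fin d) ℝ) * gᵀ →
        F y = F x)
    (hdiag : IsCnHolder n α fun r : EuclideanSpace ℝ (Fin d) =>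
      F ⟨Matrix.diagonal (fun i => r i), Matrix.isSymm_diagonal _⟩) :
    IsCnHolder n α F := by
  refine isCnHolder_of_polyMap_approx SymMat.entry hα0 hα1 fun R hR => ?_
  obtain ⟨C, D, hC, h⟩ := hdiag.exists_mvPolynomial_approx hα0 hR
  refine ⟨C, D, hC, fun N hN => ?_⟩
  obtain ⟨p, hpdeg, hp⟩ := h N hN
  obtain ⟨P, hPdeg, hP⟩ := SymMat.exists_polyMap_approx hinv hp
  exact ⟨P, hPdeg.trans hpdeg, hP⟩
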